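/- arXiv:2009.07178 — 5 statements merged into one kernel-verified Lean document; each statement's English description precedes it below -/
import Mathlib

section
/- Let ℓ, u be reals with 0 ≤ ℓ < u and let 1 < p < 2. Let ξ1* ∈ (ℓ, u) be the unique minimizer of ξ1 ↦ V_p(ℓ, ξ1, u) on (ℓ, u). Then ((u^{p−1} + ℓ^{p−1})/2)^{1/(p−1)} < (p−1)(u^p − ℓ^p)/(p(u^{p−1} − ℓ^{p−1})) < ξ1* < ((u^p − ℓ^p)/(p(u − ℓ)))^{1/(p−1)} < (u + ℓ)/2. -/
/-- The volume `V_p(ℓ, ξ₁, u)` of the perspective relaxation of the piecewise-linear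
under-estimator of `x^p` with the single non-boundary linearization point `ξ₁ = t`. -/
noncomputable def V1 (l u p t : ℝ) : ℝ :=
  -((p - 1) ^ 2 / (6 * p)) *
      (l ^ (p - 1) * t ^ (p - 1) * (t - l) ^ 2 / (t ^ (p - 1) - l ^ (p - 1))
        + t ^ (p - 1) * u ^ (p - 1) * (u - t) ^ 2 / (u ^ (p - 1) - t ^ (p - 1)))
  + ((p - 1) / (6 * p)) * (u ^ (p + 1) - l ^ (p + 1)) - (1 / 6) * (u ^ p * l - u * l ^ p)

open Set Filter Topology

lemma inv_cont (β : ℝ → ℝ) (Y : ℝ) (hY : 0 < Y) (hc : ContinuousOn β (Icc 0 Y))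
    (hm : StrictMonoOn β (Icc 0 Y)) :
    ∃ g : ℝ → ℝ, ContinuousOn g (Icc (β 0) (β Y)) ∧
      (∀ s ∈ Icc (β 0) (β Y), g s ∈ Icc 0 Y ∧ β (g s) = s) ∧
      (∀ y ∈ Icc 0 Y, g (β y) = y) := by
  have himg : β '' Icc 0 Y = Icc (β 0) (β Y) := by
    apply Subset.antisymm
    · rintro _ ⟨y, hy, rfl⟩
      exact ⟨hm.monotoneOn (left_mem_Icc.2 hY.le) hy hy.1, hm.monotoneOn hy (right_mem_Icc.2 hY.le) hy.2⟩
    · exact intermediate_value_Icc hY.le hc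
  let g := Function.invFunOn β (Icc 0 Y)
  have h1 : ∀ s ∈ Icc (β 0) (β Y), g s ∈ Icc 0 Y ∧ β (g s) = s := by
    intro s hs
    rw [← himg] at hs
    exact ⟨Function.invFunOn_mem hs, Function.invFunOn_eq hs⟩
  have h2 : ∀ y ∈ Icc 0 Y, g (β y) = y := by
    intro y hy
    have := h1 (β y) (himg ▸ mem_image_of_mem β hy)
    exact hm.injOn this.1 hy this.2
  refine ⟨g, ?_, h1, h2⟩
  have hmono : StrictMonoOn g (Icc (β 0) (β Y)) := by
    intro s hs s' hs' hss
    by_contra hcon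
    push Not at hcon
    have := hm.monotoneOn (h1 _ hs').1 (h1 _ hs).1 hcon
    rw [(h1 _ hs).2, (h1 _ hs').2] at this
    linarith
  rw [continuousOn_iff_isClosed]
  intro t ht
  refine ⟨β '' (t ∩ Icc 0 Y), ?_, ?_⟩
  · apply IsCompact.isClosed
    apply IsCompact.image_of_continuousOn (isCompact_Icc.inter_left ht)
    exact hc.mono inter_subset_right
  · ext s
    constructor
    · rintro ⟨hs, hs'⟩
      exact ⟨⟨g s, ⟨hs, (h1 s hs').1⟩, (h1 s hs').2⟩, hs'⟩
    · rintro ⟨⟨y, ⟨hy, hy'⟩, rfl⟩, hs'⟩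
      refine ⟨?_, hs'⟩
      simpa [h2 y hy'] using hy

lemma comp_lemma (α β A B α' β' a b : ℝ → ℝ) (X Y : ℝ) (hX : 0 < X) (hY : 0 < Y)
    (hαc : ContinuousOn α (Icc 0 X)) (hβc : ContinuousOn β (Icc 0 Y))
    (hAc : ContinuousOn A (Icc 0 X)) (hBc : ContinuousOn B (Icc 0 Y))
    (hα : ∀ x ∈ Ioo 0 X, HasDerivAt α (α' x) x) (hβ : ∀ x ∈ Ioo 0 Y, HasDerivAt β (β' x) x)
    (hA : ∀ x ∈ Ioo 0 X, HasDerivAt A (a x * α' x) x)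
    (hB : ∀ x ∈ Ioo 0 Y, HasDerivAt B (b x * β' x) x)
    (hα' : ∀ x ∈ Ioo 0 X, 0 < α' x) (hβ' : ∀ x ∈ Ioo 0 Y, 0 < β' x)
    (h0 : α 0 = β 0) (hAB0 : A 0 = B 0) (h1 : α X = β Y)
    (hab : ∀ x ∈ Ioo 0 X, ∀ y ∈ Ioo 0 Y, α x = β y → b y < a x) : B Y < A X := by
  have hmα : StrictMonoOn α (Icc 0 X) := by
    apply strictMonoOn_of_deriv_pos (convex_Icc 0 X) hαc
    intro x hx
    rw [interior_Icc] at hx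
    rw [(hα x hx).deriv]; exact hα' x hx
  have hmβ : StrictMonoOn β (Icc 0 Y) := by
    apply strictMonoOn_of_deriv_pos (convex_Icc 0 Y) hβc
    intro x hx
    rw [interior_Icc] at hx
    rw [(hβ x hx).deriv]; exact hβ' x hx
  obtain ⟨g, hgc, hg1, hg2⟩ := inv_cont β Y hY hβc hmβ
  have hX0 : (0:ℝ) ∈ Icc 0 X := left_mem_Icc.2 hX.le
  have hXX : X ∈ Icc 0 X := right_mem_Icc.2 hX.le
  have hY0 : (0:ℝ) ∈ Icc 0 Y := left_mem_Icc.2 hY.le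
  have hYY : Y ∈ Icc 0 Y := right_mem_Icc.2 hY.le
  have hmaps : MapsTo α (Icc 0 X) (Icc (β 0) (β Y)) := fun x hx =>
    ⟨h0 ▸ hmα.monotoneOn hX0 hx hx.1, h1 ▸ hmα.monotoneOn hx hXX hx.2⟩
  have hmono : StrictMonoOn (fun x => A x - B (g (α x))) (Icc 0 X) := by
    apply strictMonoOn_of_deriv_pos (convex_Icc 0 X)
    · apply hAc.sub
      apply hBc.comp (hgc.comp hαc hmaps)
      intro x hx
      exact (hg1 _ (hmaps hx)).1
    · intro x hx
      rw [interior_Icc] at hx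
      have hxI := Ioo_subset_Icc_self hx
      have hαx : α x ∈ Ioo (β 0) (β Y) :=
        ⟨h0 ▸ hmα hX0 hxI hx.1, h1 ▸ hmα hxI hXX hx.2⟩
      obtain ⟨hgI, hge⟩ := hg1 _ (hmaps hxI)
      have hgO : g (α x) ∈ Ioo 0 Y := by
        refine ⟨lt_of_le_of_ne hgI.1 ?_, lt_of_le_of_ne hgI.2 ?_⟩
        · intro h; rw [← h] at hge; rw [← hge] at hαx; exact lt_irrefl _ hαx.1
        · intro h; rw [h] at hge; rw [← hge] at hαx; exact lt_irrefl _ hαx.2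
      have hgd : HasDerivAt g (β' (g (α x)))⁻¹ (α x) := by
        apply HasDerivAt.of_local_left_inverse (f := β)
        · exact hgc.continuousAt (Icc_mem_nhds hαx.1 hαx.2)
        · exact hβ _ hgO
        · exact (hβ' _ hgO).ne'
        · filter_upwards [Icc_mem_nhds hαx.1 hαx.2] with s hs
          exact (hg1 s hs).2
      have hd := (hA x hx).sub ((hB _ hgO).comp x (hgd.comp x (hα x hx)))
      have hd' : HasDerivAt (fun x => A x - B (g (α x))) _ x := hd
      rw [hd'.deriv]
      have := hab x hx _ hgO hge.symm
      have hb := (hβ' _ hgO).ne'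
      have ha := hα' x hx
      have e : a x * α' x - b (g (α x)) * β' (g (α x)) * ((β' (g (α x)))⁻¹ * α' x) = (a x - b (g (α x))) * α' x := by
        field_simp
      rw [e]
      exact mul_pos (by linarith) ha
  have := hmono hX0 hXX hX
  simp only at this
  rw [h0, h1, hg2 0 hY0, hg2 Y hYY] at this
  linarith

noncomputable def Ef (k w : ℝ) : ℝ := (1 + w) ^ (k + 1) - 1 - (k + 1) / k * ((1 + w) ^ k - 1)
noncomputable def Pf (k w : ℝ) : ℝ := dslope (fun w : ℝ => (1 + w) ^ (k + 1)) 0 w / (k + 1) - 1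
noncomputable def qf (k w : ℝ) : ℝ := w ^ 3 * (1 + w) ^ (k - 1)

lemma rp_deriv (r w : ℝ) (hw : -1 < w) : HasDerivAt (fun w : ℝ => (1 + w) ^ r) (r * (1 + w) ^ (r - 1)) w := by
  have := ((hasDerivAt_id w).const_add 1).rpow_const (p := r) (Or.inl (by simp; linarith))
  simpa using this

lemma rp_cont (r : ℝ) (hr : 0 < r) : Continuous (fun w : ℝ => (1 + w) ^ r) := by
  apply Continuous.rpow_const (by fun_prop)
  intro x; right; exact hr.le

lemma Ef_cont (k : ℝ) (hk : 1 < k) : Continuous (Ef k) := by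
  unfold Ef
  have := rp_cont (k + 1) (by linarith)
  have := rp_cont k (by linarith)
  fun_prop

lemma qf_cont (k : ℝ) (hk : 1 < k) : Continuous (qf k) := by
  unfold qf
  have := rp_cont (k - 1) (by linarith)
  fun_prop

lemma Pf_ne (k w : ℝ) (hw : w ≠ 0) : Pf k w = ((1 + w) ^ (k + 1) - 1) / ((k + 1) * w) - 1 := by
  unfold Pf
  rw [dslope_of_ne _ hw, slope_def_field]
  simp
  rw [div_div, mul_comm]

lemma Pf_zero (k : ℝ) (hk : 1 < k) : Pf k 0 = 0 := by
  unfold Pf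
  rw [dslope_same, (rp_deriv (k + 1) 0 (by norm_num)).deriv]
  simp
  field_simp
  simp

lemma Pf_cont (k : ℝ) (hk : 1 < k) : Continuous (Pf k) := by
  rw [continuous_iff_continuousAt]
  intro x
  unfold Pf
  have : ContinuousAt (dslope (fun w : ℝ => (1 + w) ^ (k + 1)) 0) x := by
    by_cases hx : x = 0
    · subst hx
      rw [continuousAt_dslope_same]
      exact (rp_deriv (k + 1) 0 (by norm_num)).differentiableAt
    · rw [continuousAt_dslope_of_ne hx]
      exact (rp_cont (k + 1) (by linarith)).continuousAt
  fun_prop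

lemma Ef_deriv (k w : ℝ) (hk : 1 < k) (hw : -1 < w) :
    HasDerivAt (Ef k) ((k + 1) * (1 + w) ^ (k - 1) * w) w := by
  have h := (((rp_deriv (k + 1) w hw).sub_const 1).sub (((rp_deriv k w hw).sub_const 1).const_mul ((k + 1) / k)))
  refine HasDerivAt.congr_deriv h ?_
  have e : (1 + w) ^ (k + 1 - 1) = (1 + w) ^ (k - 1) * (1 + w) := by
    rw [← Real.rpow_add_one (by linarith)]; ring_nf
  rw [e]; field_simp; ring

lemma qf_deriv (k w : ℝ) (hw : -1 < w) :
    HasDerivAt (qf k) (w ^ 2 * (1 + w) ^ (k - 1) / (1 + w) * (3 + (k + 2) * w)) w := by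
  have h := (hasDerivAt_pow 3 w).mul (rp_deriv (k - 1) w hw)
  refine HasDerivAt.congr_deriv h ?_
  have : (0:ℝ) < 1 + w := by linarith
  have e : (1 + w) ^ (k - 1 - 1) = (1 + w) ^ (k - 1) / (1 + w) := by
    rw [← Real.rpow_sub_one (by linarith)]
  rw [e]; field_simp; push_cast; ring

lemma Pf_deriv (k w : ℝ) (hk : 1 < k) (hw : -1 < w) (h0 : w ≠ 0) :
    HasDerivAt (Pf k) (k * Ef k w / ((k + 1) * w ^ 2)) w := by
  have h := ((((rp_deriv (k + 1) w hw).sub_const 1).div ((hasDerivAt_id w).const_mul (k + 1)) 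
    (mul_ne_zero (by linarith) h0)).sub_const 1)
  have h' := h.congr_of_eventuallyEq (f₁ := Pf k) (by
    filter_upwards [isOpen_ne.mem_nhds h0] with x hx
    rw [Pf_ne k x hx]; rfl)
  refine h'.congr_deriv ?_
  unfold Ef
  have : (0:ℝ) < 1 + w := by linarith
  have e : (1 + w) ^ (k + 1) = (1 + w) ^ k * (1 + w) := by
    rw [← Real.rpow_add_one (by linarith)]
  have e2 : k + 1 - 1 = k := by ring
  rw [e2, e]; simp only [id]; field_simp; ring

lemma M_deriv (c w : ℝ) (h1 : 0 < 1 + w) (h3 : 0 < 3 + c * w) :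
    HasDerivAt (fun w => Real.log (3 + c * w) - c / 3 * Real.log (1 + w))
      (c * (3 - c) * w / (3 * ((3 + c * w) * (1 + w)))) w := by
  have h := (((((hasDerivAt_id w).const_mul c).const_add 3).log h3.ne')).sub
    ((((hasDerivAt_id w).const_add 1).log h1.ne').const_mul (c / 3))
  refine HasDerivAt.congr_deriv h ?_
  simp only [id]
  field_simp
  ring

lemma M_ineq (c y z : ℝ) (hc : 3 < c) (hz : 0 < z) (hzy : z ≤ y) (hy : c * y < 3) :
    Real.log (3 - c * y) - c / 3 * Real.log (1 - y)
      < Real.log (3 + c * z) - c / 3 * Real.log (1 + z) := by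
  set M : ℝ → ℝ := fun w => Real.log (3 + c * w) - c / 3 * Real.log (1 + w) with hM
  have hpos : ∀ w, 0 ≤ w → 0 < 1 + w ∧ 0 < 3 + c * w := fun w hw =>
    ⟨by linarith, by positivity⟩
  have hy0 : 0 < y := by linarith
  have hneg : ∀ w, w ≤ y → 0 < 1 - w ∧ 0 < 3 - c * w := fun w hw => by
    have : c * w ≤ c * y := by gcongr
    refine ⟨?_, by linarith⟩
    have : 0 < c * (1 - w) := by linarith
    exact pos_of_mul_pos_right this (by linarith)
  have h1 : M y ≤ M z := by
    have : AntitoneOn M (Icc z y) := by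
      apply antitoneOn_of_deriv_nonpos (convex_Icc z y)
      · intro w hw
        have := hpos w (by linarith [hw.1])
        exact (M_deriv c w this.1 this.2).continuousAt.continuousWithinAt
      · intro w hw
        rw [interior_Icc] at hw
        have := hpos w (by linarith [hw.1])
        exact (M_deriv c w this.1 this.2).differentiableAt.differentiableWithinAt
      · intro w hw
        rw [interior_Icc] at hw
        have := hpos w (by linarith [hw.1])
        rw [(M_deriv c w this.1 this.2).deriv]
        apply div_nonpos_of_nonpos_of_nonneg
        · have : 0 ≤ c * w * (c - 3) := mul_nonneg (mul_nonneg (by linarith) (by linarith [hw.1])) (by linarith)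
          linarith
        · exact mul_nonneg (by norm_num) (mul_pos this.2 this.1).le
    exact this (left_mem_Icc.2 hzy) (right_mem_Icc.2 hzy) hzy
  have hN : ∀ w, 0 ≤ w → w ≤ y → HasDerivAt (fun w => M w - M (-w))
      (c * (3 - c) * w / (3 * ((3 + c * w) * (1 + w))) -
       (c * (3 - c) * (-w) / (3 * ((3 + c * (-w)) * (1 + (-w))))) * (-1)) w := by
    intro w hw0 hwy
    obtain ⟨a1, a2⟩ := hpos w hw0
    obtain ⟨a3, a4⟩ := hneg w hwy
    have d1 := M_deriv c w a1 a2
    have d2 := M_deriv c (-w) (by linarith) (by linarith)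
    exact d1.sub (HasDerivAt.comp w d2 (hasDerivAt_neg w))
  have h2 : M (-y) < M y := by
    have : StrictMonoOn (fun w => M w - M (-w)) (Icc 0 y) := by
      apply strictMonoOn_of_deriv_pos (convex_Icc 0 y)
      · intro w hw
        exact (hN w hw.1 hw.2).continuousAt.continuousWithinAt
      · intro w hw
        rw [interior_Icc] at hw
        rw [(hN w hw.1.le hw.2.le).deriv]
        obtain ⟨a1, a2⟩ := hpos w hw.1.le
        obtain ⟨a3, a4⟩ := hneg w hw.2.le
        have hw0 := hw.1
        have a3' : 0 < 1 + -w := by linarith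
        have a4' : 0 < 3 + c * -w := by linarith
        have e : c * (3 - c) * w / (3 * ((3 + c * w) * (1 + w))) -
           (c * (3 - c) * (-w) / (3 * ((3 + c * (-w)) * (1 + (-w))))) * (-1)
           = c * (c - 3) * w * (2 * w * (3 + c)) / 
              (3 * ((3 + c * w) * (1 + w)) * ((3 + c * (-w)) * (1 + (-w)))) := by
          have n1 := a1.ne'
          have n2 := a2.ne'
          have n3 := a3'.ne'
          have n4 := a4'.ne'
          generalize hX : 3 + c * -w = X at n4 ⊢
          generalize hY : 1 + -w = Y at n3 ⊢
          generalize hX' : 3 + c * w = X' at n2 ⊢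
          generalize hY' : 1 + w = Y' at n1 ⊢
          field_simp
          subst hX hY hX' hY'
          ring
        rw [e]
        have : 0 < c - 3 := by linarith
        positivity
    have := this (left_mem_Icc.2 hy0.le) (right_mem_Icc.2 hy0.le) hy0
    simp only [neg_zero, sub_self] at this
    linarith
  have e : M (-y) = Real.log (3 - c * y) - c / 3 * Real.log (1 - y) := by
    simp only [hM, mul_neg, ← sub_eq_add_neg]
  rw [← e]
  exact lt_of_lt_of_le h2 h1

lemma slope_ineq (k y z : ℝ) (hk : 1 < k) (hy0 : 0 < y) (hz : 0 < z) (hy : (k + 2) * y < 3)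
    (hq : -qf k (-y) = qf k z) :
    (1 + z) / (z * (3 + (k + 2) * z)) < (1 - y) / (y * (3 - (k + 2) * y)) := by
  have hy1 : 0 < 1 - y := by nlinarith
  have hz1 : 0 < 1 + z := by linarith
  have hq' : y ^ 3 * (1 - y) ^ (k - 1) = z ^ 3 * (1 + z) ^ (k - 1) := by
    unfold qf at hq
    rw [← hq, ← sub_eq_add_neg]; ring
  have hzy : z ≤ y := by
    by_contra hcon
    push Not at hcon
    have h1 : y ^ 3 < z ^ 3 := by gcongr
    have h2 : (1 - y) ^ (k - 1) ≤ 1 := Real.rpow_le_one hy1.le (by linarith) (by linarith)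
    have h3 : 1 ≤ (1 + z) ^ (k - 1) := Real.one_le_rpow (by linarith) (by linarith)
    have : y ^ 3 * (1 - y) ^ (k - 1) < z ^ 3 * (1 + z) ^ (k - 1) := by
      calc _ ≤ y ^ 3 * 1 := by gcongr
        _ < z ^ 3 * 1 := by linarith
        _ ≤ _ := by gcongr
    linarith
  have hM := M_ineq (k + 2) y z (by linarith) hz hzy hy
  have hlog := congrArg Real.log hq'
  have hp1 := Real.rpow_pos_of_pos hy1 (k - 1)
  have hp2 := Real.rpow_pos_of_pos hz1 (k - 1)
  rw [Real.log_mul (by positivity) hp1.ne', Real.log_mul (by positivity) hp2.ne', Real.log_pow, Real.log_pow,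
    Real.log_rpow hy1, Real.log_rpow hz1] at hlog
  have hA : 0 < 3 - (k + 2) * y := by linarith
  have hB : 0 < 3 + (k + 2) * z := by nlinarith
  rw [← Real.log_lt_log_iff (by positivity) (by positivity)]
  rw [Real.log_div (by positivity) (by positivity), Real.log_div (by positivity) (by positivity),
    Real.log_mul (by positivity) (by positivity), Real.log_mul (by positivity) (by positivity)]
  push_cast at hlog
  linarith

lemma Ef_mono (k : ℝ) (hk : 1 < k) : StrictMonoOn (Ef k) (Ici 0) := by
  apply strictMonoOn_of_deriv_pos (convex_Ici 0) (Ef_cont k hk).continuousOn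
  intro w hw
  rw [interior_Ici] at hw
  have hw : 0 < w := hw
  rw [(Ef_deriv k w hk (by linarith)).deriv]
  positivity

lemma qf_mono (k : ℝ) (hk : 1 < k) : StrictMonoOn (qf k) (Ici 0) := by
  apply strictMonoOn_of_deriv_pos (convex_Ici 0) (qf_cont k hk).continuousOn
  intro w hw
  rw [interior_Ici] at hw
  have hw : 0 < w := hw
  rw [(qf_deriv k w (by linarith)).deriv]
  positivity

lemma neg_deriv (f : ℝ → ℝ) (f' y : ℝ) (h : HasDerivAt f f' (-y)) :
    HasDerivAt (fun y => f (-y)) (-f') y := by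
  have := HasDerivAt.comp y h (hasDerivAt_neg y)
  rw [mul_neg_one] at this
  exact this

lemma Efn_mono (k : ℝ) (hk : 1 < k) : StrictMonoOn (fun y => Ef k (-y)) (Icc 0 1) := by
  apply strictMonoOn_of_deriv_pos (convex_Icc 0 1) 
  · exact ((Ef_cont k hk).comp continuous_neg).continuousOn
  intro w hw
  rw [interior_Icc] at hw
  rw [(neg_deriv _ _ _ (Ef_deriv k (-w) hk (by linarith [hw.2]))).deriv]
  have h1 : 0 < 1 + -w := by linarith [hw.2]
  have := hw.1
  have : 0 < (k + 1) * (1 + -w) ^ (k - 1) * w := by positivity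
  linarith

lemma Ef_zero (k : ℝ) : Ef k 0 = 0 := by simp [Ef]
lemma qf_zero (k : ℝ) : qf k 0 = 0 := by simp [qf]

lemma qn_deriv (k y : ℝ) (hy : y < 1) : HasDerivAt (fun y => -qf k (-y))
    (y ^ 2 * (1 - y) ^ (k - 1) / (1 - y) * (3 - (k + 2) * y)) y := by
  have := (neg_deriv _ _ _ (qf_deriv k (-y) (by linarith))).neg
  refine HasDerivAt.congr_deriv this ?_
  simp only [← sub_eq_add_neg]
  ring

lemma E_of_q (k y z : ℝ) (hk : 1 < k) (hy0 : 0 < y) (hz : 0 < z) (hy : (k + 2) * y ≤ 3)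
    (hq : -qf k (-y) = qf k z) : Ef k z < Ef k (-y) := by
  have hy1 : y < 1 := by nlinarith
  have hlt : ∀ x ∈ Ioo 0 y, (k + 2) * x < 3 := fun x hx => by
    have : (k + 2) * x < (k + 2) * y := by
      apply mul_lt_mul_of_pos_left hx.2; linarith
    linarith
  refine comp_lemma (fun y => -qf k (-y)) (qf k) (fun y => Ef k (-y)) (Ef k)
    (fun y => y ^ 2 * (1 - y) ^ (k - 1) / (1 - y) * (3 - (k + 2) * y))
    (fun w => w ^ 2 * (1 + w) ^ (k - 1) / (1 + w) * (3 + (k + 2) * w))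
    (fun y => (k + 1) * ((1 - y) / (y * (3 - (k + 2) * y))))
    (fun z => (k + 1) * ((1 + z) / (z * (3 + (k + 2) * z)))) y z hy0 hz
    ((qf_cont k hk).comp continuous_neg).neg.continuousOn (qf_cont k hk).continuousOn
    ((Ef_cont k hk).comp continuous_neg).continuousOn (Ef_cont k hk).continuousOn
    ?_ ?_ ?_ ?_ ?_ ?_ ?_ ?_ hq ?_
  · intro x hx; exact qn_deriv k x (by linarith [hx.2])
  · intro x hx; exact qf_deriv k x (by linarith [hx.1])
  · intro x hx
    have h1 : 0 < 1 - x := by linarith [hx.2]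
    have h2 : 0 < 3 - (k + 2) * x := by linarith [hlt x hx]
    have h3 := hx.1
    refine (neg_deriv _ _ _ (Ef_deriv k (-x) hk (by linarith))).congr_deriv ?_
    simp only [← sub_eq_add_neg]
    generalize 3 - (k + 2) * x = X at h2 ⊢
    field_simp
  · intro x hx
    have h3 := hx.1
    have h2 : 0 < 3 + (k + 2) * x := by positivity
    refine (Ef_deriv k x hk (by linarith)).congr_deriv ?_
    field_simp
  · intro x hx
    have h1 : 0 < 1 - x := by linarith [hx.2]
    have h2 : 0 < 3 - (k + 2) * x := by linarith [hlt x hx]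
    have h3 := hx.1
    positivity
  · intro x hx
    have h3 := hx.1
    positivity
  · simp [qf_zero]
  · simp
  · intro x hx w hw h
    have := slope_ineq k x w hk hx.1 hw.1 (hlt x hx) h
    apply mul_lt_mul_of_pos_left this
    linarith

lemma exists_q (k z v : ℝ) (hk : 1 < k) (hz : 0 < z) (hv : qf k z ≤ v) :
    ∃ z', z ≤ z' ∧ qf k z' = v := by
  have hqz : 0 < qf k z := by unfold qf; positivity
  have hb : v ≤ qf k (z + v + 1) := by
    unfold qf
    have h1 : 1 ≤ (1 + (z + v + 1)) ^ (k - 1) := Real.one_le_rpow (by linarith) (by linarith)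
    have h2 : 1 ≤ (z + v + 1) ^ 2 := one_le_pow₀ (by linarith)
    have h3 : v ≤ (z + v + 1) ^ 3 := by nlinarith
    have h4 : 0 < (z + v + 1) ^ 3 := by linarith
    nlinarith
  obtain ⟨z', h, h'⟩ := intermediate_value_Icc (by linarith : z ≤ z + v + 1) (qf_cont k hk).continuousOn ⟨hv, hb⟩
  exact ⟨z', h.1, h'⟩

lemma q_of_E (k y z : ℝ) (hk : 1 < k) (hy0 : 0 < y) (hy1 : y < 1) (hz : 0 < z)
    (hE : Ef k (-y) = Ef k z) : -qf k (-y) < qf k z := by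
  by_contra hcon
  push Not at hcon
  have key : ∃ y', 0 < y' ∧ y' ≤ y ∧ (k + 2) * y' ≤ 3 ∧ -qf k (-y) ≤ -qf k (-y') := by
    by_cases h : (k + 2) * y ≤ 3
    · exact ⟨y, hy0, le_rfl, h, le_rfl⟩
    · push Not at h
      have hk2 : 0 < k + 2 := by linarith
      have hle : 3 / (k + 2) ≤ y := by rw [div_le_iff₀ hk2]; linarith
      refine ⟨3 / (k + 2), by positivity, hle, by field_simp; rfl, ?_⟩
      have : AntitoneOn (fun y => -qf k (-y)) (Icc (3 / (k + 2)) y) := by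
        apply antitoneOn_of_deriv_nonpos (convex_Icc _ _)
        · exact ((qf_cont k hk).comp continuous_neg).neg.continuousOn
        · intro w hw
          rw [interior_Icc] at hw
          exact (qn_deriv k w (by linarith [hw.2])).differentiableAt.differentiableWithinAt
        · intro w hw
          rw [interior_Icc] at hw
          rw [(qn_deriv k w (by linarith [hw.2])).deriv]
          have h1 : 0 < 1 - w := by linarith [hw.2]
          have h2 := hw.1
          rw [div_lt_iff₀ hk2] at h2
          apply mul_nonpos_of_nonneg_of_nonpos
          · positivity
          · linarith
      exact this (left_mem_Icc.2 hle) (right_mem_Icc.2 hle) hle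
  obtain ⟨y', h1, h2, h3, h4⟩ := key
  obtain ⟨z', hz', hqz'⟩ := exists_q k z _ hk hz (hcon.trans h4)
  have h5 := E_of_q k y' z' hk h1 (by linarith) h3 hqz'.symm
  have h6 := (Efn_mono k hk).monotoneOn (show y' ∈ Icc (0:ℝ) 1 from ⟨h1.le, by linarith⟩) 
    (show y ∈ Icc (0:ℝ) 1 from ⟨hy0.le, hy1.le⟩) h2
  have h7 := (Ef_mono k hk).monotoneOn (show z ∈ Ici (0:ℝ) from hz.le) 
    (show z' ∈ Ici (0:ℝ) from by simp; linarith) hz'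
  linarith

lemma Ef_pos (k z : ℝ) (hk : 1 < k) (hz : 0 < z) : 0 < Ef k z := by
  have := Ef_mono k hk (show (0:ℝ) ∈ Ici 0 by simp) (show z ∈ Ici (0:ℝ) from hz.le) hz
  rwa [Ef_zero] at this

lemma Efn_pos (k y : ℝ) (hk : 1 < k) (hy : 0 < y) (hy1 : y ≤ 1) : 0 < Ef k (-y) := by
  have := Efn_mono k hk (show (0:ℝ) ∈ Icc 0 1 by simp) (show y ∈ Icc (0:ℝ) 1 from ⟨hy.le, hy1⟩) hy
  simpa [Ef_zero] using this

lemma Pf_mono (k : ℝ) (hk : 1 < k) : StrictMonoOn (Pf k) (Ici 0) := by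
  apply strictMonoOn_of_deriv_pos (convex_Ici 0) (Pf_cont k hk).continuousOn
  intro w hw
  rw [interior_Ici] at hw
  have hw : 0 < w := hw
  rw [(Pf_deriv k w hk (by linarith) hw.ne').deriv]
  have := Ef_pos k w hk hw
  positivity

lemma P_of_E (k y z : ℝ) (hk : 1 < k) (hy0 : 0 < y) (hy1 : y ≤ 1) (hz : 0 < z)
    (hE : Ef k (-y) = Ef k z) : Pf k z < -Pf k (-y) := by
  refine comp_lemma (fun y => Ef k (-y)) (Ef k) (fun y => -Pf k (-y)) (Pf k) 
    (fun y => (k + 1) * (1 - y) ^ (k - 1) * y)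
    (fun w => (k + 1) * (1 + w) ^ (k - 1) * w)
    (fun y => k / (k + 1) ^ 2 * (Ef k (-y) / (-qf k (-y))))
    (fun z => k / (k + 1) ^ 2 * (Ef k z / (qf k z))) y z hy0 hz
    ((Ef_cont k hk).comp continuous_neg).continuousOn (Ef_cont k hk).continuousOn
    ((Pf_cont k hk).comp continuous_neg).neg.continuousOn (Pf_cont k hk).continuousOn
    ?_ ?_ ?_ ?_ ?_ ?_ ?_ ?_ hE ?_
  · intro x hx
    refine (neg_deriv _ _ _ (Ef_deriv k (-x) hk (by linarith [hx.2]))).congr_deriv ?_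
    simp only [← sub_eq_add_neg]
    ring
  · intro x hx; exact Ef_deriv k x hk (by linarith [hx.1])
  · intro x hx
    have h1 : 0 < 1 - x := by linarith [hx.2]
    have h3 := hx.1
    refine (neg_deriv _ _ _ (Pf_deriv k (-x) hk (by linarith) (by linarith))).neg.congr_deriv ?_
    unfold qf
    simp only [← sub_eq_add_neg]
    field_simp
  · intro x hx
    have h3 := hx.1
    refine (Pf_deriv k x hk (by linarith) (by linarith)).congr_deriv ?_
    unfold qf
    field_simp
  · intro x hx
    have h1 : 0 < 1 - x := by linarith [hx.2]
    have h3 := hx.1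
    positivity
  · intro x hx
    have h3 := hx.1
    positivity
  · simp
  · simp [Pf_zero k hk]
  · intro x hx w hw h
    have := q_of_E k x w hk hx.1 (by linarith [hx.2]) hw.1 h
    have h0 : 0 < -qf k (-x) := by
      have h1 : 0 < 1 + -x := by linarith [hx.2]
      have h3 := hx.1
      have e : -qf k (-x) = x ^ 3 * (1 + -x) ^ (k - 1) := by unfold qf; ring
      rw [e]; positivity
    have hp := Ef_pos k w hk hw.1
    rw [h]
    apply mul_lt_mul_of_pos_left _ (by positivity)
    exact div_lt_div_of_pos_left hp h0 this

lemma E_exists (k z v : ℝ) (hk : 1 < k) (hz : 0 < z) (hv : Ef k z ≤ v) :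
    ∃ z', z ≤ z' ∧ Ef k z' = v := by
  have hp := Ef_pos k z hk hz
  have hb : v ≤ Ef k (z + v + 2) := by
    unfold Ef
    have e : (1 + (z + v + 2)) ^ (k + 1) = (1 + (z + v + 2)) ^ k * (1 + (z + v + 2)) := by
      rw [← Real.rpow_add_one (by linarith)]
    have h1 : 1 ≤ (1 + (z + v + 2)) ^ k := Real.one_le_rpow (by linarith) (by linarith)
    have h2 : (k + 1) / k ≤ 2 := by rw [div_le_iff₀ (by linarith)]; linarith
    have h3 : 1 ≤ (k + 1) / k := by rw [le_div_iff₀ (by linarith)]; linarith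
    rw [e]
    set R := (1 + (z + v + 2)) ^ k
    have : (k + 1) / k * (R - 1) ≤ 2 * (R - 1) := by
      apply mul_le_mul_of_nonneg_right h2; linarith
    nlinarith
  obtain ⟨z', h, h'⟩ := intermediate_value_Icc (by linarith : z ≤ z + v + 2) (Ef_cont k hk).continuousOn ⟨hv, hb⟩
  exact ⟨z', h.1, h'⟩

lemma E_lt (k y z : ℝ) (hk : 1 < k) (hy0 : 0 < y) (hy1 : y ≤ 1) (hz : 0 < z)
    (hP : Pf k z = -Pf k (-y)) : Ef k (-y) < Ef k z := by
  by_contra hcon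
  push Not at hcon
  obtain ⟨z', h, h'⟩ := E_exists k z _ hk hz hcon
  have h1 := P_of_E k y z' hk hy0 hy1 (by linarith) h'.symm
  have := (Pf_mono k hk).monotoneOn (show z ∈ Ici (0:ℝ) from hz.le) 
    (show z' ∈ Ici (0:ℝ) from by simp; linarith) h
  linarith

lemma sym_gt (k y : ℝ) (hk : 1 < k) (hy0 : 0 < y) (hy1 : y ≤ 1) :
    2 * (k + 1) * y < (1 + y) ^ (k + 1) - (1 - y) ^ (k + 1) := by
  have hd : ∀ w ∈ Ioo (0:ℝ) 1, HasDerivAt 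
      (fun y : ℝ => (1 + y) ^ (k + 1) - (1 + -y) ^ (k + 1) - 2 * (k + 1) * y) 
      ((k + 1) * ((1 + w) ^ k + (1 + -w) ^ k - 2)) w := by
    intro w hw
    have h1 := rp_deriv (k + 1) w (by linarith [hw.1])
    have h2 := neg_deriv _ _ _ (rp_deriv (k + 1) (-w) (by linarith [hw.2]))
    refine ((h1.sub h2).sub ((hasDerivAt_id w).const_mul (2 * (k + 1)))).congr_deriv ?_
    rw [add_sub_cancel_right]; ring
  have : StrictMonoOn (fun y : ℝ => (1 + y) ^ (k + 1) - (1 + -y) ^ (k + 1) - 2 * (k + 1) * y) (Icc 0 1) := by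
    apply strictMonoOn_of_deriv_pos (convex_Icc 0 1)
    · have h1 := rp_cont (k + 1) (by linarith)
      have h2 := h1.comp continuous_neg
      exact ((h1.sub h2).sub (by fun_prop)).continuousOn
    · intro w hw
      rw [interior_Icc] at hw
      rw [(hd w hw).deriv]
      have b1 := one_add_mul_self_lt_rpow_one_add (s := w) (by linarith [hw.1]) hw.1.ne' hk
      have b2 := one_add_mul_self_lt_rpow_one_add (s := -w) (by linarith [hw.2]) (by linarith [hw.1]) hk
      apply mul_pos <;> linarith
  have := this (left_mem_Icc.2 zero_le_one) (show y ∈ Icc (0:ℝ) 1 from ⟨hy0.le, hy1⟩) hy0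
  simp [← sub_eq_add_neg] at this
  linarith

lemma sym_lt (p y : ℝ) (hp1 : 1 < p) (hp2 : p < 2) (hy0 : 0 < y) (hy1 : y ≤ 1) :
    (1 + y) ^ p - (1 - y) ^ p < 2 * p * y := by
  have hd : ∀ w ∈ Ioo (0:ℝ) 1, HasDerivAt 
      (fun y : ℝ => 2 * p * y - ((1 + y) ^ p - (1 + -y) ^ p)) 
      (p * (2 - (1 + w) ^ (p - 1) - (1 + -w) ^ (p - 1))) w := by
    intro w hw
    have h1 := rp_deriv p w (by linarith [hw.1])
    have h2 := neg_deriv _ _ _ (rp_deriv p (-w) (by linarith [hw.2]))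
    refine (((hasDerivAt_id w).const_mul (2 * p)).sub (h1.sub h2)).congr_deriv ?_
    ring
  have : StrictMonoOn (fun y : ℝ => 2 * p * y - ((1 + y) ^ p - (1 + -y) ^ p)) (Icc 0 1) := by
    apply strictMonoOn_of_deriv_pos (convex_Icc 0 1)
    · have h1 := rp_cont p (by linarith)
      have h2 := h1.comp continuous_neg
      exact (Continuous.sub (by fun_prop) (h1.sub h2)).continuousOn
    · intro w hw
      rw [interior_Icc] at hw
      rw [(hd w hw).deriv]
      have b1 := rpow_one_add_lt_one_add_mul_self (s := w) (by linarith [hw.1]) hw.1.ne' (by linarith : 0 < p - 1) (by linarith)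
      have b2 := rpow_one_add_lt_one_add_mul_self (s := -w) (by linarith [hw.2]) (by linarith [hw.1]) (by linarith : 0 < p - 1) (by linarith)
      apply mul_pos <;> linarith
  have := this (left_mem_Icc.2 zero_le_one) (show y ∈ Icc (0:ℝ) 1 from ⟨hy0.le, hy1⟩) hy0
  simp [← sub_eq_add_neg] at this
  linarith

lemma z_lt_y (k y z : ℝ) (hk : 1 < k) (hy0 : 0 < y) (hy1 : y ≤ 1) (hz : 0 < z)
    (hP : Pf k z = -Pf k (-y)) : z < y := by
  by_contra hcon
  push Not at hcon
  have h1 := (Pf_mono k hk).monotoneOn (show y ∈ Ici (0:ℝ) from hy0.le) (show z ∈ Ici (0:ℝ) from hz.le) hcon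
  rw [hP] at h1
  rw [Pf_ne k y hy0.ne', Pf_ne k (-y) (by linarith)] at h1
  have h2 := sym_gt k y hk hy0 hy1
  rw [← sub_eq_add_neg] at h1
  have hk1 : 0 < k + 1 := by linarith
  have e : ((1 + y) ^ (k + 1) - 1) / ((k + 1) * y) - 1 + (((1 - y) ^ (k + 1) - 1) / ((k + 1) * -y) - 1)
    = ((1 + y) ^ (k + 1) - (1 - y) ^ (k + 1) - 2 * (k + 1) * y) / ((k + 1) * y) := by
    field_simp; ring
  have : 0 < ((1 + y) ^ (k + 1) - (1 - y) ^ (k + 1) - 2 * (k + 1) * y) / ((k + 1) * y) :=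
    div_pos (by linarith) (by positivity)
  linarith

lemma Pn_pos (k y : ℝ) (hk : 1 < k) (hy0 : 0 < y) (hy1 : y ≤ 1) : 0 < -Pf k (-y) := by
  rw [Pf_ne k (-y) (by linarith)]
  have b2 := one_add_mul_self_lt_rpow_one_add (s := -y) (by linarith) (by linarith) (by linarith : 1 < k + 1)
  have hk1 : 0 < k + 1 := by linarith
  have e : -(((1 + -y) ^ (k + 1) - 1) / ((k + 1) * -y) - 1) = ((1 + -y) ^ (k + 1) - (1 + (k + 1) * -y)) / ((k + 1) * y) := by
    field_simp; ring
  rw [e]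
  exact div_pos (by linarith) (by positivity)

lemma Pp_pos (k z : ℝ) (hk : 1 < k) (hz : 0 < z) : 0 < Pf k z := by
  have := Pf_mono k hk (show (0:ℝ) ∈ Ici 0 by simp) (show z ∈ Ici (0:ℝ) from hz.le) hz
  rwa [Pf_zero k hk] at this

lemma V1_deriv (l u p t : ℝ) (ht : 0 < t) (h1 : l ^ (p - 1) < t ^ (p - 1))
    (h2 : t ^ (p - 1) < u ^ (p - 1)) (hp : 1 < p) :
    HasDerivAt (V1 l u p) (-((p - 1) ^ 2 / (6 * p)) *
      ((u ^ (p - 1) * (u - t) / (u ^ (p - 1) - t ^ (p - 1))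
         - l ^ (p - 1) * (t - l) / (t ^ (p - 1) - l ^ (p - 1))) *
       ((p - 1) * t ^ (p - 1) / t * (l ^ (p - 1) * (t - l) / (t ^ (p - 1) - l ^ (p - 1))
         + u ^ (p - 1) * (u - t) / (u ^ (p - 1) - t ^ (p - 1))) - 2 * t ^ (p - 1)))) t := by
  have hT : HasDerivAt (fun x : ℝ => x ^ (p - 1)) ((p - 1) * t ^ (p - 1) / t) t := by
    refine (Real.hasDerivAt_rpow_const (Or.inl ht.ne')).congr_deriv ?_
    rw [Real.rpow_sub_one ht.ne', mul_div_assoc]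
  have a1 := ((hT.const_mul (l ^ (p - 1))).mul (((hasDerivAt_id t).sub_const l).pow 2)).div
    (hT.sub_const (l ^ (p - 1))) (sub_pos.2 h1).ne'
  have a2 := ((hT.mul_const (u ^ (p - 1))).mul (((hasDerivAt_id t).const_sub u).pow 2)).div
    (hT.const_sub (u ^ (p - 1))) (sub_pos.2 h2).ne'
  have h := ((((a1.add a2).const_mul (-((p - 1) ^ 2 / (6 * p)))).add_const
    (((p - 1) / (6 * p)) * (u ^ (p + 1) - l ^ (p + 1)))).sub_const ((1 / 6) * (u ^ p * l - u * l ^ p)))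
  refine HasDerivAt.congr_deriv (f := V1 l u p) h ?_
  congr 1
  simp only [id, Pi.mul_apply, Pi.pow_apply]
  have n1 := (sub_pos.2 h1).ne'
  have n2 := (sub_pos.2 h2).ne'
  generalize t ^ (p - 1) = T at *
  generalize l ^ (p - 1) = L at *
  generalize u ^ (p - 1) = U at *
  generalize hX : T - L = X at n1 ⊢
  generalize hY : U - T = Y at n2 ⊢
  have e1 : L = T - X := by linarith
  have e2 : U = T + Y := by linarith
  subst e1 e2
  field_simp
  push_cast
  ring

/-- Bounds on the minimizer of `ξ₁ ↦ V_p(ℓ, ξ₁, u)` for `1 < p < 2`: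
`((u^{p−1}+ℓ^{p−1})/2)^{1/(p−1)} < (p−1)(uᵖ−ℓᵖ)/(p(u^{p−1}−ℓ^{p−1})) < ξ₁*
  < ((uᵖ−ℓᵖ)/(p(u−ℓ)))^{1/(p−1)} < (u+ℓ)/2`. -/
theorem minimizer_bounds_of_p_lt_two (l u : ℝ) (hl : 0 ≤ l) (hlu : l < u)
    (p : ℝ) (hp1 : 1 < p) (hp2 : p < 2)
    (xstar : ℝ) (hx : xstar ∈ Set.Ioo l u)
    (hmin : ∀ t ∈ Set.Ioo l u, V1 l u p xstar ≤ V1 l u p t) :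
    ((u ^ (p - 1) + l ^ (p - 1)) / 2) ^ (1 / (p - 1))
        < (p - 1) * (u ^ p - l ^ p) / (p * (u ^ (p - 1) - l ^ (p - 1))) ∧
    (p - 1) * (u ^ p - l ^ p) / (p * (u ^ (p - 1) - l ^ (p - 1))) < xstar ∧
    xstar < ((u ^ p - l ^ p) / (p * (u - l))) ^ (1 / (p - 1)) ∧
    ((u ^ p - l ^ p) / (p * (u - l))) ^ (1 / (p - 1)) < (u + l) / 2 := by
  obtain ⟨hx1, hx2⟩ := hx
  set t := xstar with ht_def
  have ht : 0 < t := by linarith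
  have hu : 0 < u := by linarith
  have ha0 : 0 < p - 1 := by linarith
  have hpl : l ^ p = l ^ (p - 1) * l := by
    rw [← Real.rpow_add_one' hl (by linarith)]; ring_nf
  have hpu : u ^ p = u ^ (p - 1) * u := by
    rw [← Real.rpow_add_one' hu.le (by linarith)]; ring_nf
  have hLT : l ^ (p - 1) < t ^ (p - 1) := Real.rpow_lt_rpow hl hx1 ha0
  have hTU : t ^ (p - 1) < u ^ (p - 1) := Real.rpow_lt_rpow ht.le hx2 ha0
  have hder : _ = (0:ℝ) := IsLocalMin.hasDerivAt_eq_zero (f := V1 l u p) (a := t) (by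
    filter_upwards [Ioo_mem_nhds hx1 hx2] with s hs
    exact hmin s hs) (V1_deriv l u p t ht hLT hTU hp1)
  have h4 : ((u ^ p - l ^ p) / (p * (u - l))) ^ (1 / (p - 1)) < (u + l) / 2 := by
    have hm : 0 < (u + l) / 2 := by linarith
    set m := (u + l) / 2 with hm_def
    have hy0 : 0 < (u - l) / (2 * m) := div_pos (by linarith) (by linarith)
    have hy1 : (u - l) / (2 * m) ≤ 1 := by rw [div_le_one (by linarith)]; linarith
    have key := sym_lt p _ hp1 hp2 hy0 hy1
    have e1 : 1 + (u - l) / (2 * m) = u / m := by field_simp; linarith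
    have e2 : 1 - (u - l) / (2 * m) = l / m := by field_simp; linarith
    rw [e1, e2, Real.div_rpow hu.le hm.le, Real.div_rpow hl hm.le] at key
    have hmp : m ^ p = m ^ (p - 1) * m := by
      rw [← Real.rpow_add_one' hm.le (by linarith)]; ring_nf
    have hma : 0 < m ^ (p - 1) := Real.rpow_pos_of_pos hm _
    have hlt : (u ^ p - l ^ p) / (p * (u - l)) < m ^ (p - 1) := by
      rw [hmp, ← sub_div, div_lt_iff₀ (by positivity)] at key
      rw [div_lt_iff₀ (mul_pos (by linarith) (by linarith))]
      have : 2 * p * ((u - l) / (2 * m)) * (m ^ (p - 1) * m) = m ^ (p - 1) * (p * (u - l)) := by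
        field_simp
      linarith
    have hnn : 0 ≤ (u ^ p - l ^ p) / (p * (u - l)) := by
      apply div_nonneg
      · have := Real.rpow_le_rpow hl hlu.le (by linarith : 0 ≤ p)
        linarith
      · exact mul_nonneg (by linarith) (by linarith)
    calc _ < (m ^ (p - 1)) ^ (1 / (p - 1)) := Real.rpow_lt_rpow hnn hlt (by positivity)
      _ = m := by rw [one_div, Real.rpow_rpow_inv hm.le ha0.ne']
  have hTpos : 0 < t ^ (p - 1) := Real.rpow_pos_of_pos ht _
  have hL0 : 0 ≤ l ^ (p - 1) := Real.rpow_nonneg hl _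
  obtain ⟨k, hk⟩ : ∃ k, k = 1 / (p - 1) := ⟨_, rfl⟩
  have hk1 : 1 < k := by rw [hk, lt_div_iff₀ ha0]; linarith
  have hlk : (l ^ (p - 1)) ^ k = l := by rw [hk, one_div, Real.rpow_rpow_inv hl ha0.ne']
  have htk : (t ^ (p - 1)) ^ k = t := by rw [hk, one_div, Real.rpow_rpow_inv ht.le ha0.ne']
  have huk : (u ^ (p - 1)) ^ k = u := by rw [hk, one_div, Real.rpow_rpow_inv hu.le ha0.ne']
  have hpk : p = (k + 1) / k := by rw [hk]; field_simp; ring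
  have hak : p - 1 = 1 / k := by rw [hk]; field_simp
  have hk0 : 0 < k := by linarith
  have h3red : t ^ (p - 1) < (u ^ p - l ^ p) / (p * (u - l)) → 
      t < ((u ^ p - l ^ p) / (p * (u - l))) ^ (1 / (p - 1)) := by
    intro h
    calc t = (t ^ (p - 1)) ^ (1 / (p - 1)) := by rw [← hk, htk]
      _ < _ := Real.rpow_lt_rpow hTpos.le h (by positivity)
  rw [hpl, hpu] at *
  rw [← hk] at *
  generalize l ^ (p - 1) = L at *
  generalize t ^ (p - 1) = T at *
  generalize u ^ (p - 1) = U at *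
  rw [hak] at *
  rw [hpk] at *
  have hU : 0 < U := by linarith
  have h1 : ((U + L) / 2) ^ k < 1 / k * (U * u - L * l) / ((k + 1) / k * (U - L)) := by
    have hm : 0 < (U + L) / 2 := by linarith
    set m := (U + L) / 2 with hm_def
    have hy0 : 0 < (U - L) / (2 * m) := div_pos (by linarith) (by linarith)
    have hy1 : (U - L) / (2 * m) ≤ 1 := by rw [div_le_one (by linarith)]; linarith
    have key := sym_gt k _ hk1 hy0 hy1
    have e1 : 1 + (U - L) / (2 * m) = U / m := by field_simp; linarith
    have e2 : 1 - (U - L) / (2 * m) = L / m := by field_simp; linarith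
    have hk10 : k + 1 ≠ 0 := by linarith
    rw [e1, e2, Real.div_rpow hU.le hm.le, Real.div_rpow hL0 hm.le, Real.rpow_add_one' hU.le hk10,
      Real.rpow_add_one' hL0 hk10, Real.rpow_add_one' hm.le hk10, huk, hlk] at key
    have hmk : 0 < m ^ k := Real.rpow_pos_of_pos hm _
    rw [← sub_div, lt_div_iff₀ (by positivity)] at key
    rw [lt_div_iff₀ (mul_pos (by positivity) (by linarith))]
    have : 2 * (k + 1) * ((U - L) / (2 * m)) * (m ^ k * m) = (k + 1) * m ^ k * (U - L) := by
      field_simp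
    rw [this] at key
    field_simp
    linarith
  obtain ⟨y, hy⟩ : ∃ y, y = 1 - L / T := ⟨_, rfl⟩
  obtain ⟨z, hz⟩ : ∃ z, z = U / T - 1 := ⟨_, rfl⟩
  have hy0 : 0 < y := by rw [hy, sub_pos, div_lt_one hTpos]; exact hLT
  have hy1 : y ≤ 1 := by rw [hy]; linarith [div_nonneg hL0 hTpos.le]
  have hz0 : 0 < z := by rw [hz, sub_pos, one_lt_div hTpos]; exact hTU
  have hLy : L = T * (1 - y) := by rw [hy]; field_simp; ring
  have hUz : U = T * (1 + z) := by rw [hz]; field_simp; ring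
  have hyk : (1 + -y) ^ k = l / t := by
    rw [show 1 + -y = L / T by rw [hy]; ring, Real.div_rpow hL0 hTpos.le, hlk, htk]
  have hzk : (1 + z) ^ k = u / t := by
    rw [show 1 + z = U / T by rw [hz]; ring, Real.div_rpow hU.le hTpos.le, huk, htk]
  have hyk1 : (1 + -y) ^ (k + 1) = l / t * (1 - y) := by
    rw [Real.rpow_add_one' (by linarith) (by linarith), hyk]; ring
  have hzk1 : (1 + z) ^ (k + 1) = u / t * (1 + z) := by
    rw [Real.rpow_add_one' (by linarith) (by linarith), hzk]
  have hPn := Pn_pos k y hk1 hy0 hy1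
  have hPp := Pp_pos k z hk1 hz0
  obtain ⟨P, hP⟩ : ∃ P, P = -Pf k (-y) := ⟨_, rfl⟩
  obtain ⟨Q, hQ⟩ : ∃ Q, Q = Pf k z := ⟨_, rfl⟩
  have eP : l * (1 - y) = t * (1 - (k + 1) * y * (1 - P)) := by
    rw [hP, Pf_ne k (-y) (by linarith), hyk1]
    field_simp
    ring
  have eQ : u * (1 + z) = t * (1 + (k + 1) * z * (1 + Q)) := by
    rw [hQ, Pf_ne k z hz0.ne', hzk1]
    field_simp
    ring
  have g1 : L * (t - l) / (T - L) = t * (k - (k + 1) * P) := by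
    rw [div_eq_iff (by linarith), hLy]
    linear_combination (-T) * eP
  have g2 : U * (u - t) / (U - T) = t * (k + (k + 1) * Q) := by
    rw [div_eq_iff (by linarith), hUz]
    linear_combination T * eQ
  rw [← hP] at hPn
  rw [← hQ] at hPp
  have hPQ : Q = P := by
    rw [g1, g2] at hder
    have e : (-((1 / k) ^ 2 / (6 * ((k + 1) / k))) * ((t * (k + (k + 1) * Q) - t * (k - (k + 1) * P)) *
      (1 / k * T / t * (t * (k - (k + 1) * P) + t * (k + (k + 1) * Q)) - 2 * T)))
      = -((1 / k) ^ 2 / (6 * ((k + 1) / k))) * (t * (k + 1) * (P + Q)) * (T * (k + 1) / k) * (Q - P) := by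
      field_simp
      ring
    rw [e] at hder
    have hne : -((1 / k) ^ 2 / (6 * ((k + 1) / k))) * (t * (k + 1) * (P + Q)) * (T * (k + 1) / k) ≠ 0 := by
      have : 0 < ((1 / k) ^ 2 / (6 * ((k + 1) / k))) * (t * (k + 1) * (P + Q)) * (T * (k + 1) / k) := by positivity
      intro h
      linarith
    have := (mul_eq_zero.1 hder).resolve_left hne
    linarith
  have hPf : Pf k z = -Pf k (-y) := by rw [← hP, ← hQ, hPQ]
  have hzy := z_lt_y k y z hk1 hy0 hy1 hz0 hPf
  have hE := E_lt k y z hk1 hy0 hy1 hz0 hPf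
  rw [one_div_one_div] at h4
  refine ⟨h1, ?_, h3red ?_, h4⟩
  · rw [div_lt_iff₀ (mul_pos (by positivity) (by linarith)), hLy, hUz]
    subst hPQ
    have e : 1 / k * (T * (1 + z) * u - T * (1 - y) * l) = 
       1 / k * T * t * ((k + 1) * (z * (1 + Q) + y * (1 - Q))) := by
      linear_combination 1 / k * T * (eQ - eP)
    rw [e]
    have e2 : t * ((k + 1) / k * (T * (1 + z) - T * (1 - y))) - 1 / k * T * t * ((k + 1) * (z * (1 + Q) + y * (1 - Q)))
      = 1 / k * T * t * (k + 1) * (Q * (y - z)) := by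
      field_simp
      ring
    have : 0 < 1 / k * T * t * (k + 1) * (Q * (y - z)) := by
      have : 0 < y - z := by linarith
      positivity
    linarith
  · unfold Ef at hE
    rw [hyk, hyk1, hzk, hzk1] at hE
    rw [lt_div_iff₀ (mul_pos (by positivity) (by linarith)), hLy, hUz]
    have e : T * (1 + z) * u - T * (1 - y) * l - T * ((k + 1) / k * (u - l))
       = T * t * ((u / t * (1 + z) - 1 - (k + 1) / k * (u / t - 1)) - (l / t * (1 - y) - 1 - (k + 1) / k * (l / t - 1))) := by
      field_simp
      ring
    have : 0 < T * t * ((u / t * (1 + z) - 1 - (k + 1) / k * (u / t - 1)) - (l / t * (1 - y) - 1 - (k + 1) / k * (l / t - 1))) :=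
      mul_pos (by positivity) (by linarith)
    linarith
end

section
/- Let ℓ, u be reals with 0 ≤ ℓ < u and let p > 2. Let ξ1* ∈ (ℓ, u) be the unique minimizer of ξ1 ↦ V_p(ℓ, ξ1, u) on (ℓ, u). Then ((u^{p−1} + ℓ^{p−1})/2)^{1/(p−1)} > (p−1)(u^p − ℓ^p)/(p(u^{p−1} − ℓ^{p−1})) > ξ1* > ((u^p − ℓ^p)/(p(u − ℓ)))^{1/(p−1)} > (u + ℓ)/2. -/
open Set

lemma exists_inv (f : ℝ → ℝ) (a b : ℝ) (hab : a ≤ b) (hf : ContinuousOn f (Icc a b))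
    (hm : StrictMonoOn f (Icc a b)) :
    ∃ φ : ℝ → ℝ, ContinuousOn φ (Icc (f a) (f b)) ∧ (∀ z ∈ Icc (f a) (f b), φ z ∈ Icc a b ∧ f (φ z) = z) := by
  have hs : ∀ z : Icc (f a) (f b), ∃ x : Icc a b, f x = z := by
    intro z
    obtain ⟨x, hx, h⟩ := intermediate_value_Icc hab hf z.2
    exact ⟨⟨x, hx⟩, h⟩
  choose ψ hψ using hs
  have hmono : Monotone ψ := by
    intro z w hzw
    have : f (ψ z) ≤ f (ψ w) := by rw [hψ, hψ]; exact hzw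
    exact (hm.le_iff_le (ψ z).2 (ψ w).2).1 this
  have hsurj : Function.Surjective ψ := by
    intro x
    have hx : f x ∈ Icc (f a) (f b) :=
      ⟨hm.monotoneOn (left_mem_Icc.2 hab) x.2 x.2.1, hm.monotoneOn x.2 (right_mem_Icc.2 hab) x.2.2⟩
    exact ⟨⟨f x, hx⟩, Subtype.ext (hm.injOn (ψ _).2 x.2 (hψ _))⟩
  have hc : Continuous ψ := hmono.continuous_of_surjective hsurj
  classical
  refine ⟨fun z => if h : z ∈ Icc (f a) (f b) then (ψ ⟨z, h⟩ : ℝ) else 0, ?_, ?_⟩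
  · rw [continuousOn_iff_continuous_domRestrict]
    have : (Icc (f a) (f b)).domRestrict (fun z => if h : z ∈ Icc (f a) (f b) then (ψ ⟨z, h⟩ : ℝ) else 0)
        = fun z => (ψ z : ℝ) := by
      ext z
      simp only [Set.domRestrict_apply]
      rw [dif_pos z.2]
    rw [this]
    exact continuous_subtype_val.comp hc
  · intro z hz
    simp only [dif_pos hz]
    exact ⟨(ψ _).2, hψ _⟩

lemma compare_along (l c u : ℝ) (hl : l < c) (hu : c < u) (f g F G f' g' F' G' : ℝ → ℝ)
    (hfc : ContinuousOn f (Icc c u)) (hgc : ContinuousOn g (Icc l c))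
    (hFc : ContinuousOn F (Icc c u)) (hGc : ContinuousOn G (Icc l c))
    (hf : ∀ x ∈ Ioo c u, HasDerivAt f (f' x) x) (hg : ∀ x ∈ Ioo l c, HasDerivAt g (g' x) x)
    (hF : ∀ x ∈ Ioo c u, HasDerivAt F (F' x) x) (hG : ∀ x ∈ Ioo l c, HasDerivAt G (G' x) x)
    (hf0 : ∀ x ∈ Ioo c u, 0 < f' x) (hg0 : ∀ x ∈ Ioo l c, g' x < 0)
    (h1 : f c = g c) (h2 : F c = G c) (h3 : f u = g l)
    (key : ∀ x ∈ Ioo c u, ∀ y ∈ Ioo l c, f x = g y → F' x * g' y < G' y * f' x) :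
    G l < F u := by
  have hfm : StrictMonoOn f (Icc c u) := by
    apply strictMonoOn_of_deriv_pos (convex_Icc _ _) hfc
    intro x hx
    rw [interior_Icc] at hx
    rw [(hf x hx).deriv]; exact hf0 x hx
  have hgm : StrictAntiOn g (Icc l c) := by
    apply strictAntiOn_of_deriv_neg (convex_Icc _ _) hgc
    intro x hx
    rw [interior_Icc] at hx
    rw [(hg x hx).deriv]; exact hg0 x hx
  obtain ⟨φ, hφc, hφ⟩ := exists_inv f c u hu.le hfc hfm
  have hgmap : MapsTo g (Icc l c) (Icc (f c) (f u)) := by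
    intro y hy
    rw [h1, h3]
    exact ⟨hgm.antitoneOn hy (right_mem_Icc.2 hl.le) hy.2, hgm.antitoneOn (left_mem_Icc.2 hl.le) hy hy.1⟩
  have hD : StrictAntiOn (fun y => F (φ (g y)) - G y) (Icc l c) := by
    apply strictAntiOn_of_deriv_neg (convex_Icc _ _)
    · refine ContinuousOn.sub ?_ hGc
      exact hFc.comp (hφc.comp hgc hgmap) (fun y hy => (hφ _ (hgmap hy)).1)
    · intro y hy
      rw [interior_Icc] at hy
      have hyI := Ioo_subset_Icc_self hy
      have hz : g y ∈ Ioo (f c) (f u) := by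
        rw [h1, h3]
        exact ⟨hgm hyI (right_mem_Icc.2 hl.le) hy.2, hgm (left_mem_Icc.2 hl.le) hyI hy.1⟩
      obtain ⟨hx, hfx⟩ := hφ _ (hgmap hyI)
      have hxo : φ (g y) ∈ Ioo c u := by
        refine ⟨lt_of_le_of_ne hx.1 ?_, lt_of_le_of_ne hx.2 ?_⟩
        · intro h; rw [← h] at hfx; exact absurd hfx hz.1.ne
        · intro h; rw [h] at hfx; exact absurd hfx hz.2.ne'
      have hd : HasDerivAt φ (f' (φ (g y)))⁻¹ (g y) := by
        apply HasDerivAt.of_local_left_inverse (hφc.continuousAt (Icc_mem_nhds hz.1 hz.2))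
          (hf _ hxo) (hf0 _ hxo).ne'
        filter_upwards [Icc_mem_nhds hz.1 hz.2] with z hz
        exact (hφ z hz).2
      have hd2 := ((hF _ hxo).comp y (hd.comp y (hg y hy))).sub (hG y hy)
      have : deriv (fun y => F (φ (g y)) - G y) y = _ := hd2.deriv
      rw [this]
      have hk := key _ hxo y hy hfx
      have hp := hf0 _ hxo
      have : F' (φ (g y)) * ((f' (φ (g y)))⁻¹ * g' y) = F' (φ (g y)) * g' y / f' (φ (g y)) := by
        field_simp
      rw [this, sub_neg, div_lt_iff₀ hp]
      exact hk
  have e1 : φ (g c) = c := by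
    obtain ⟨hx, hfx⟩ := hφ _ (hgmap (right_mem_Icc.2 hl.le))
    exact hfm.injOn hx (left_mem_Icc.2 hu.le) (by rw [hfx, h1])
  have e2 : φ (g l) = u := by
    obtain ⟨hx, hfx⟩ := hφ _ (hgmap (left_mem_Icc.2 hl.le))
    exact hfm.injOn hx (right_mem_Icc.2 hu.le) (by rw [hfx, h3])
  have := hD (left_mem_Icc.2 hl.le) (right_mem_Icc.2 hl.le) hl
  simp only [e1, e2, h2] at this
  linarith

lemma hermite_hadamard (a b : ℝ) (hab : a < b) (G g : ℝ → ℝ)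
    (hG : ∀ x ∈ Icc a b, HasDerivAt G (g x) x) (hg : StrictConvexOn ℝ (Icc a b) g) :
    g ((a + b) / 2) * (b - a) < G b - G a := by
  set c := (a + b) / 2 with hc
  have hder : ∀ h ∈ Icc 0 ((b - a) / 2), HasDerivAt (fun h => G (c + h) - G (c - h) - 2 * h * g c)
      (g (c + h) + g (c - h) - 2 * g c) h := by
    intro h hh
    have i1 : HasDerivAt (fun h => c + h) 1 h := (hasDerivAt_id h).const_add c
    have i2 : HasDerivAt (fun h => c - h) (-1) h := (hasDerivAt_id h).const_sub c
    have d1 := (hG (c + h) ⟨by linarith [hh.1, hh.2], by linarith [hh.1, hh.2]⟩).comp h i1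
    have d2 := (hG (c - h) ⟨by linarith [hh.1, hh.2], by linarith [hh.1, hh.2]⟩).comp h i2
    have d3 := (((hasDerivAt_id h).const_mul 2).mul_const (g c))
    exact ((d1.sub d2).sub d3).congr_deriv (by ring)
  have hm : StrictMonoOn (fun h => G (c + h) - G (c - h) - 2 * h * g c) (Icc 0 ((b - a) / 2)) := by
    apply strictMonoOn_of_deriv_pos (convex_Icc _ _)
    · exact fun h hh => (hder h hh).continuousAt.continuousWithinAt
    · intro h hh
      rw [interior_Icc] at hh
      rw [(hder h (Ioo_subset_Icc_self hh)).deriv]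
      have := hg.2 (show c + h ∈ Icc a b from ⟨by linarith [hh.1, hh.2], by linarith [hh.1, hh.2]⟩)
        (show c - h ∈ Icc a b from ⟨by linarith [hh.1, hh.2], by linarith [hh.1, hh.2]⟩)
        (by intro h'; linarith [hh.1]) (show (0 : ℝ) < 1 / 2 by norm_num)
        (show (0 : ℝ) < 1 / 2 by norm_num) (by norm_num)
      simp only [smul_eq_mul] at this
      rw [show 1 / 2 * (c + h) + 1 / 2 * (c - h) = c by ring] at this
      linarith
  have := hm (left_mem_Icc.2 (by linarith)) (right_mem_Icc.2 (by linarith)) (by linarith : (0:ℝ) < (b - a) / 2)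
  simp only [add_zero, sub_zero] at this
  rw [show c + (b - a) / 2 = b by rw [hc]; ring, show c - (b - a) / 2 = a by rw [hc]; ring] at this
  linarith

lemma young_strict (q x t : ℝ) (hq : 1 < q) (hx : 0 ≤ x) (ht : 0 ≤ t) (hxt : x ≠ t) :
    (q + 1) * t * x ^ q < q * (x ^ q * x) + t ^ q * t := by
  rcases hx.eq_or_lt with rfl | hx
  · have : 0 < t := lt_of_le_of_ne ht hxt
    rw [Real.zero_rpow (by linarith)]
    have := Real.rpow_pos_of_pos this q
    simp only [mul_zero, zero_add]
    positivity
  · have h1 : (-1 : ℝ) ≤ t / x - 1 := by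
      have : 0 ≤ t / x := by positivity
      linarith
    have h2 : t / x - 1 ≠ 0 := by
      intro h
      apply hxt
      field_simp at h
      linarith
    have h := one_add_mul_self_lt_rpow_one_add h1 h2 (show 1 < q + 1 by linarith)
    rw [show 1 + (t / x - 1) = t / x by ring, Real.div_rpow ht hx.le,
      Real.rpow_add_one' ht (by linarith), Real.rpow_add_one hx.ne'] at h
    have hp : 0 < x ^ q := Real.rpow_pos_of_pos hx q
    have hp2 : 0 < x ^ q * x := by positivity
    rw [lt_div_iff₀ hp2] at h
    have : (1 + (q + 1) * (t / x - 1)) * (x ^ q * x) = (q + 1) * t * x ^ q - q * (x ^ q * x) := by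
      field_simp
      ring
    linarith

section core

variable (e : ℝ)

/-- auxiliary functions -/
noncomputable def auxR (e x : ℝ) : ℝ := x ^ (2 * e + 1) - x ^ (-e)
noncomputable def auxR' (e x : ℝ) : ℝ := (2 * e + 1) * x ^ (2 * e) + e * x ^ (-e - 1)
noncomputable def auxW (e x : ℝ) : ℝ := (2 * e + 1) * x ^ e + e * x ^ (-2 * e - 1)
noncomputable def auxP (e x : ℝ) : ℝ := x ^ (3 * e + 2) - (3 * e + 2) * x

lemma hasDerivAt_auxR {x : ℝ} (hx : 0 < x) : HasDerivAt (auxR e) (auxR' e x) x := by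
  have h1 := Real.hasDerivAt_rpow_const (x := x) (p := 2 * e + 1) (Or.inl hx.ne')
  have h2 := Real.hasDerivAt_rpow_const (x := x) (p := -e) (Or.inl hx.ne')
  refine (h1.sub h2).congr_deriv ?_
  unfold auxR'
  rw [show 2 * e + 1 - 1 = 2 * e by ring]
  ring

lemma hasDerivAt_auxW {x : ℝ} (hx : 0 < x) :
    HasDerivAt (auxW e) (e * (2 * e + 1) * auxR e x * x ^ (-e - 2)) x := by
  have h1 := (Real.hasDerivAt_rpow_const (x := x) (p := e) (Or.inl hx.ne')).const_mul (2 * e + 1)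
  have h2 := (Real.hasDerivAt_rpow_const (x := x) (p := -2 * e - 1) (Or.inl hx.ne')).const_mul e
  refine (h1.add h2).congr_deriv ?_
  unfold auxR
  rw [mul_assoc _ _ (x ^ (-e - 2)), sub_mul (x ^ (2 * e + 1)), ← Real.rpow_add hx, ← Real.rpow_add hx,
    show 2 * e + 1 + (-e - 2) = e - 1 by ring, show -e + (-e - 2) = -2 * e - 1 - 1 by ring]
  ring

lemma auxR_mul {x : ℝ} (hx : 0 < x) : auxR e x * x ^ e = x ^ (3 * e + 1) - 1 := by
  unfold auxR
  rw [sub_mul, ← Real.rpow_add hx, ← Real.rpow_add hx, show 2 * e + 1 + e = 3 * e + 1 by ring,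
    show -e + e = 0 by ring, Real.rpow_zero]

lemma hasDerivAt_auxP {x : ℝ} (hx : 0 < x) :
    HasDerivAt (auxP e) ((3 * e + 2) * (auxR e x * x ^ e)) x := by
  have h1 := Real.hasDerivAt_rpow_const (x := x) (p := 3 * e + 2) (Or.inl hx.ne')
  have h2 := (hasDerivAt_id x).const_mul (3 * e + 2)
  refine (h1.sub h2).congr_deriv ?_
  rw [auxR_mul e hx, show 3 * e + 2 - 1 = 3 * e + 1 by ring]
  ring

lemma auxR'_eq_W {x : ℝ} (hx : 0 < x) : auxR' e x = x ^ e * auxW e x := by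
  unfold auxR' auxW
  rw [mul_add, mul_left_comm, mul_left_comm _ e, ← Real.rpow_add hx, ← Real.rpow_add hx]
  congr 3 <;> ring_nf

lemma auxR'_eq_P {x : ℝ} (hx : 0 < x) :
    auxR' e x = x ^ (-e - 2) * ((2 * e + 1) * x ^ (3 * e + 2) + e * x) := by
  unfold auxR'
  rw [mul_add, mul_left_comm, mul_left_comm _ e, ← Real.rpow_add hx, ← Real.rpow_add_one hx.ne']
  congr 3 <;> ring_nf

variable {e}

lemma auxR'_pos (he : 0 < e) {x : ℝ} (hx : 0 < x) : 0 < auxR' e x := by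
  unfold auxR'; positivity

lemma auxR_pos (he : 0 < e) {x : ℝ} (hx : 1 < x) : 0 < auxR e x := by
  unfold auxR
  have h1 := Real.one_lt_rpow hx (show 0 < 2 * e + 1 by linarith)
  have h2 := Real.rpow_lt_one_of_one_lt_of_neg hx (show -e < 0 by linarith)
  linarith

lemma auxR_neg (he : 0 < e) {x : ℝ} (hx0 : 0 < x) (hx : x < 1) : auxR e x < 0 := by
  unfold auxR
  have h1 := Real.rpow_lt_one hx0.le hx (show 0 < 2 * e + 1 by linarith)
  have h2 := Real.one_lt_rpow_of_pos_of_lt_one_of_neg hx0 hx (show -e < 0 by linarith)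
  linarith

lemma auxR_one : auxR e 1 = 0 := by simp [auxR]

lemma step3 (he : 0 < e) {x y : ℝ} (hy0 : 0 < y) (hy : y < 1) (hx : 1 < x)
    (h : auxR e x = -auxR e y) : auxW e x < auxW e y := by
  have pos : ∀ z ∈ Icc y x, 0 < z := fun z hz => lt_of_lt_of_le hy0 hz.1
  have key := compare_along y 1 x hy hx (auxR e) (fun z => -auxR e z) (fun z => -auxW e z)
    (fun z => -auxW e z) (auxR' e) (fun z => -auxR' e z)
    (fun z => -(e * (2 * e + 1) * auxR e z * z ^ (-e - 2)))
    (fun z => -(e * (2 * e + 1) * auxR e z * z ^ (-e - 2)))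
    (fun z hz => (hasDerivAt_auxR e (by linarith [hz.1])).continuousAt.continuousWithinAt)
    (fun z hz => (hasDerivAt_auxR e (by linarith [hz.1])).neg.continuousAt.continuousWithinAt)
    (fun z hz => (hasDerivAt_auxW e (by linarith [hz.1])).neg.continuousAt.continuousWithinAt)
    (fun z hz => (hasDerivAt_auxW e (by linarith [hz.1])).neg.continuousAt.continuousWithinAt)
    (fun z hz => (hasDerivAt_auxR e (by linarith [hz.1])))
    (fun z hz => (hasDerivAt_auxR e (by linarith [hz.1])).neg)
    (fun z hz => (hasDerivAt_auxW e (by linarith [hz.1])).neg)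
    (fun z hz => (hasDerivAt_auxW e (by linarith [hz.1])).neg)
    (fun z hz => auxR'_pos he (by linarith [hz.1]))
    (fun z hz => neg_lt_zero.2 (auxR'_pos he (by linarith [hz.1])))
    (by simp [auxR_one]) rfl h ?_
  · simpa using key
  · intro a ha b hb hab
    have ha0 : 0 < a := by linarith [ha.1]
    have hb0 : 0 < b := by linarith [hb.1]
    have hba : b < a := by linarith [ha.1, hb.2]
    have hR := auxR_pos he ha.1
    have hRb : auxR e b = -auxR e a := by linarith
    rw [hRb, auxR'_eq_P e ha0, auxR'_eq_P e hb0]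
    have hA : 0 < a ^ (-e - 2) := Real.rpow_pos_of_pos ha0 _
    have hB : 0 < b ^ (-e - 2) := Real.rpow_pos_of_pos hb0 _
    have hP : (2 * e + 1) * b ^ (3 * e + 2) + e * b < (2 * e + 1) * a ^ (3 * e + 2) + e * a := by
      have := Real.rpow_lt_rpow hb0.le hba (show 0 < 3 * e + 2 by linarith)
      gcongr
    have hc : 0 < e * (2 * e + 1) * auxR e a * a ^ (-e - 2) * b ^ (-e - 2) := by positivity
    have := mul_lt_mul_of_pos_left hP hc
    linarith

lemma step2 (he : 0 < e) {x y : ℝ} (hy0 : 0 < y) (hy : y < 1) (hx : 1 < x)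
    (h : auxR e x = -auxR e y) : auxP e y < auxP e x := by
  refine compare_along y 1 x hy hx (auxR e) (fun z => -auxR e z) (auxP e)
    (auxP e) (auxR' e) (fun z => -auxR' e z)
    (fun z => ((3 * e + 2) * (auxR e z * z ^ e)))
    (fun z => ((3 * e + 2) * (auxR e z * z ^ e)))
    (fun z hz => (hasDerivAt_auxR e (by linarith [hz.1])).continuousAt.continuousWithinAt)
    (fun z hz => (hasDerivAt_auxR e (by linarith [hz.1])).neg.continuousAt.continuousWithinAt)
    (fun z hz => (hasDerivAt_auxP e (by linarith [hz.1])).continuousAt.continuousWithinAt)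
    (fun z hz => (hasDerivAt_auxP e (by linarith [hz.1])).continuousAt.continuousWithinAt)
    (fun z hz => (hasDerivAt_auxR e (by linarith [hz.1])))
    (fun z hz => (hasDerivAt_auxR e (by linarith [hz.1])).neg)
    (fun z hz => (hasDerivAt_auxP e (by linarith [hz.1])))
    (fun z hz => (hasDerivAt_auxP e (by linarith [hz.1])))
    (fun z hz => auxR'_pos he (by linarith [hz.1]))
    (fun z hz => neg_lt_zero.2 (auxR'_pos he (by linarith [hz.1])))
    (by simp [auxR_one]) rfl h ?_
  intro a ha b hb hab
  have ha0 : 0 < a := by linarith [ha.1]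
  have hb0 : 0 < b := by linarith [hb.1]
  have hR := auxR_pos he ha.1
  have hW := step3 he hb0 hb.2 ha.1 hab
  have hRb : auxR e b = -auxR e a := by linarith
  rw [hRb, auxR'_eq_W e ha0, auxR'_eq_W e hb0]
  have hA : 0 < a ^ e := Real.rpow_pos_of_pos ha0 _
  have hB : 0 < b ^ e := Real.rpow_pos_of_pos hb0 _
  have hc : 0 < (3 * e + 2) * auxR e a * a ^ e * b ^ e := by positivity
  have := mul_lt_mul_of_pos_left hW hc
  linarith

lemma step2' (he : 0 < e) {x y : ℝ} (hy0 : 0 < y) (hy : y < 1) (hx : 1 < x)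
    (h : auxP e x = auxP e y) : auxR e x < -auxR e y := by
  by_contra! hcon
  have hRy := auxR_neg he hy0 hy
  have hc : ContinuousOn (auxR e) (Icc 1 x) :=
    fun z hz => (hasDerivAt_auxR e (by linarith [hz.1])).continuousAt.continuousWithinAt
  obtain ⟨z, hz, hz2⟩ := intermediate_value_Icc hx.le hc
    (show -auxR e y ∈ Icc (auxR e 1) (auxR e x) from ⟨by rw [auxR_one]; linarith, hcon⟩)
  have hz1 : 1 < z := by
    refine lt_of_le_of_ne hz.1 ?_
    rintro rfl
    rw [auxR_one] at hz2
    linarith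
  have h1 := step2 he hy0 hy hz1 hz2
  have hm : StrictMonoOn (auxP e) (Icc 1 x) := by
    apply strictMonoOn_of_deriv_pos (convex_Icc _ _)
    · exact fun z hz => (hasDerivAt_auxP e (by linarith [hz.1])).continuousAt.continuousWithinAt
    · intro w hw
      rw [interior_Icc] at hw
      have hw0 : 0 < w := by linarith [hw.1]
      rw [(hasDerivAt_auxP e hw0).deriv]
      have := auxR_pos he hw.1
      positivity
  have := hm.monotoneOn hz (right_mem_Icc.2 hx.le) hz.2
  linarith

noncomputable def auxK (q x : ℝ) : ℝ := x ^ q / dslope (fun z : ℝ => z ^ q) 1 x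

lemma auxK_eq {q x : ℝ} (hx : x ≠ 1) : auxK q x = x ^ q * (x - 1) / (x ^ q - 1) := by
  unfold auxK
  rw [dslope_of_ne _ hx, slope_def_field, Real.one_rpow, div_div_eq_mul_div]

lemma auxK_one {q : ℝ} : auxK q 1 = 1 / q := by
  unfold auxK
  rw [dslope_same, (Real.hasDerivAt_rpow_const (x := 1) (p := q) (Or.inl one_ne_zero)).deriv]
  simp

lemma auxK_cont {q : ℝ} (hq : 1 < q) : ContinuousOn (auxK q) (Ici 0) := by
  have hc : Continuous (fun z : ℝ => z ^ q) := Real.continuous_rpow_const (by linarith)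
  have hd : Continuous (dslope (fun z : ℝ => z ^ q) 1) := by
    rw [← continuousOn_univ, continuousOn_dslope Filter.univ_mem]
    exact ⟨hc.continuousOn,
      (Real.hasDerivAt_rpow_const (x := 1) (p := q) (Or.inl one_ne_zero)).differentiableAt⟩
  refine hc.continuousOn.div hd.continuousOn ?_
  intro x hx
  have hx : 0 ≤ x := hx
  rcases lt_trichotomy x 1 with h | h | h
  · rw [dslope_of_ne _ h.ne, slope_def_field, Real.one_rpow]
    have := Real.rpow_lt_one hx h (show 0 < q by linarith)
    exact (div_pos_of_neg_of_neg (by linarith) (by linarith)).ne'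
  · rw [h, dslope_same, (Real.hasDerivAt_rpow_const (x := 1) (p := q) (Or.inl one_ne_zero)).deriv]
    simp; linarith
  · rw [dslope_of_ne _ h.ne', slope_def_field, Real.one_rpow]
    have := Real.one_lt_rpow h (show 0 < q by linarith)
    exact (div_pos (by linarith) (by linarith)).ne'

lemma hasDerivAt_auxK (he : 0 < e) {x : ℝ} (hx : 0 < x) (h1 : x ≠ 1) :
    HasDerivAt (auxK (3 * e + 1)) (x ^ e * (auxP e x + (3 * e + 1)) / auxR e x ^ 2) x := by
  have hR : auxR e x ≠ 0 := by
    rcases lt_or_gt_of_ne h1 with h | h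
    · exact (auxR_neg he hx h).ne
    · exact (auxR_pos he h).ne'
  have hX : 0 < x ^ e := Real.rpow_pos_of_pos hx _
  have hm := auxR_mul e hx
  have hne : x ^ (3 * e + 1) - 1 ≠ 0 := by rw [← hm]; exact mul_ne_zero hR hX.ne'
  have d1 := Real.hasDerivAt_rpow_const (x := x) (p := 3 * e + 1) (Or.inl hx.ne')
  have d := (d1.mul ((hasDerivAt_id x).sub_const 1)).div (d1.sub_const 1) hne
  refine (d.congr_of_eventuallyEq ?_).congr_deriv ?_
  · filter_upwards [isOpen_ne.mem_nhds h1] with z hz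
    exact auxK_eq hz
  · have e1 : x ^ (3 * e + 1 - 1) = (x ^ e) ^ 3 := by
      rw [← Real.rpow_natCast, ← Real.rpow_mul hx.le]; congr 1; push_cast; ring
    have e2 : x ^ (3 * e + 1) = (x ^ e) ^ 3 * x := by
      rw [← e1, ← Real.rpow_add_one hx.ne']; congr 1; ring
    have e3 : x ^ (3 * e + 2) = (x ^ e) ^ 3 * x * x := by
      rw [← e2, ← Real.rpow_add_one hx.ne']; congr 1; ring
    have hR2 : auxR e x = (x ^ (3 * e + 1) - 1) / x ^ e := by rw [← hm]; field_simp
    unfold auxP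
    rw [hR2]
    simp only [e1, e2, e3, id, Pi.mul_apply] at hne ⊢
    set X := x ^ e
    field_simp
    ring

lemma step1 (he : 0 < e) {l u : ℝ} (hl0 : 0 ≤ l) (hl : l < 1) (hu : 1 < u)
    (h : auxP e u = auxP e l) :
    2 / (3 * e + 1) < auxK (3 * e + 1) l + auxK (3 * e + 1) u := by
  have hPc : Continuous (auxP e) :=
    (Real.continuous_rpow_const (by linarith)).sub (continuous_const.mul continuous_id)
  have hKc := auxK_cont (show 1 < 3 * e + 1 by linarith)
  have key := compare_along l 1 u hl hu (auxP e) (auxP e) (auxK (3 * e + 1))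
    (fun z => 2 / (3 * e + 1) - auxK (3 * e + 1) z)
    (fun z => ((3 * e + 2) * (auxR e z * z ^ e)))
    (fun z => ((3 * e + 2) * (auxR e z * z ^ e)))
    (fun x => x ^ e * (auxP e x + (3 * e + 1)) / auxR e x ^ 2)
    (fun x => -(x ^ e * (auxP e x + (3 * e + 1)) / auxR e x ^ 2))
    hPc.continuousOn hPc.continuousOn
    (hKc.mono fun z hz => le_trans zero_le_one hz.1)
    (continuousOn_const.sub (hKc.mono fun z hz => le_trans hl0 hz.1))
    (fun z hz => (hasDerivAt_auxP e (by linarith [hz.1])))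
    (fun z hz => (hasDerivAt_auxP e (by linarith [hz.1])))
    (fun z hz => (hasDerivAt_auxK he (by linarith [hz.1]) hz.1.ne'))
    (fun z hz => (hasDerivAt_auxK he (by linarith [hz.1]) hz.2.ne).const_sub _)
    (fun z hz => ?_) (fun z hz => ?_) rfl ?_ h ?_
  · linarith
  · have h0 : 0 < z := by linarith [hz.1]
    have := auxR_pos he hz.1
    positivity
  · have h0 : 0 < z := by linarith [hz.1]
    have := auxR_neg he h0 hz.2
    have hz := Real.rpow_pos_of_pos h0 e
    have : auxR e z * z ^ e < 0 := mul_neg_of_neg_of_pos this hz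
    nlinarith
  · rw [auxK_one]; ring
  · intro a ha b hb hab
    have ha0 : 0 < a := by linarith [ha.1]
    have hb0 : 0 < b := by linarith [hb.1]
    have hRa := auxR_pos he ha.1
    have hRb := auxR_neg he hb0 hb.2
    have hlt := step2' he hb0 hb.2 ha.1 hab
    have hN : 0 < auxP e a + (3 * e + 1) := by
      have := young_strict (3 * e + 1) 1 a (by linarith) zero_le_one ha0.le ha.1.ne
      rw [← Real.rpow_add_one ha0.ne', Real.one_rpow] at this
      unfold auxP
      rw [show 3 * e + 2 = 3 * e + 1 + 1 by ring]
      linarith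
    rw [← hab]
    have hA : 0 < a ^ e := Real.rpow_pos_of_pos ha0 _
    have hB : 0 < b ^ e := Real.rpow_pos_of_pos hb0 _
    obtain ⟨r, hr⟩ : ∃ r, r = -auxR e b := ⟨_, rfl⟩
    have hb' : auxR e b = -r := by linarith
    rw [hb']
    rw [← hr] at hlt
    have hr0 : 0 < r := by linarith
    set s := auxR e a
    have h3 : s ^ 3 < r ^ 3 := by gcongr
    have hc : 0 < (3 * e + 2) * (auxP e a + (3 * e + 1)) * a ^ e * b ^ e := by positivity
    have hq : s / r ^ 2 < r / s ^ 2 := by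
      rw [div_lt_div_iff₀ (by positivity) (by positivity)]
      linarith
    have := mul_lt_mul_of_pos_left hq hc
    have t1 : a ^ e * (auxP e a + (3 * e + 1)) / s ^ 2 * ((3 * e + 2) * (-r * b ^ e))
      = -((3 * e + 2) * (auxP e a + (3 * e + 1)) * a ^ e * b ^ e * (r / s ^ 2)) := by ring
    have t2 : -(b ^ e * (auxP e a + (3 * e + 1)) / (-r) ^ 2) * ((3 * e + 2) * (s * a ^ e))
      = -((3 * e + 2) * (auxP e a + (3 * e + 1)) * a ^ e * b ^ e * (s / r ^ 2)) := by
      rw [neg_sq]; ring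
    rw [t1, t2]
    linarith

end core

/-- The function whose zero is the critical point. -/
noncomputable def auxH (l u q t : ℝ) : ℝ :=
  l ^ q * (t - l) / (t ^ q - l ^ q) + u ^ q * (u - t) / (u ^ q - t ^ q) - 2 * t / q

lemma auxH_anti {l u q : ℝ} (hl : 0 ≤ l) (hq : 1 < q) {s t : ℝ}
    (hs : l < s) (hst : s < t) (ht : t < u) : auxH l u q t < auxH l u q s := by
  have hconv := strictConvexOn_rpow hq
  have hs0 : 0 ≤ s := by linarith
  have ht0 : 0 ≤ t := by linarith
  have hu0 : 0 ≤ u := by linarith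
  have hq0 : 0 < q := by linarith
  have hL : 0 ≤ l ^ q := Real.rpow_nonneg hl q
  have h1 := Real.rpow_lt_rpow hl hs hq0
  have h2 := Real.rpow_lt_rpow hs0 hst hq0
  have h3 := Real.rpow_lt_rpow ht0 ht hq0
  have a1 := hconv.secant_strict_mono (a := l) (x := s) (y := t) hl hs0 ht0 hs.ne' (by linarith : l < t).ne' hst
  have a2 := hconv.secant_strict_mono (a := u) (x := s) (y := t) hu0 hs0 ht0 (by linarith : s < u).ne ht.ne hst
  have b1 : (t - l) / (t ^ q - l ^ q) ≤ (s - l) / (s ^ q - l ^ q) := by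
    rw [div_lt_div_iff₀ (by linarith) (by linarith)] at a1
    rw [div_le_div_iff₀ (by linarith) (by linarith)]
    linarith
  have b2 : (u - t) / (u ^ q - t ^ q) ≤ (u - s) / (u ^ q - s ^ q) := by
    rw [← neg_div_neg_eq, ← neg_div_neg_eq (t ^ q - u ^ q), div_lt_div_iff₀ (by linarith) (by linarith)] at a2
    rw [div_le_div_iff₀ (by linarith) (by linarith)]
    linarith
  have b3 : 2 * s / q < 2 * t / q := by gcongr
  have c1 := mul_le_mul_of_nonneg_left b1 hL
  have c2 := mul_le_mul_of_nonneg_left b2 (show 0 ≤ u ^ q by linarith)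
  unfold auxH
  rw [mul_div_assoc, mul_div_assoc, mul_div_assoc (l ^ q), mul_div_assoc (u ^ q)]
  linarith

lemma auxH_lower {l u q t : ℝ} (hl : 0 ≤ l) (hq : 1 < q) (hlt : l < t) (htu : t < u)
    (h : (q + 1) * t ^ q * (u - l) = u ^ q * u - l ^ q * l) : 0 < auxH l u q t := by
  have ht0 : 0 < t := by linarith
  have hu0 : 0 < u := by linarith
  have hq0 : 0 < q := by linarith
  obtain ⟨e, rfl⟩ : ∃ e, q = 3 * e + 1 := ⟨(q - 1) / 3, by ring⟩
  have he : 0 < e := by linarith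
  have hT : 0 < t ^ (3 * e + 1) := Real.rpow_pos_of_pos ht0 _
  have h1 := Real.rpow_lt_rpow hl hlt hq0
  have h2 := Real.rpow_lt_rpow ht0.le htu hq0
  have hl1 : l / t < 1 := (div_lt_one ht0).2 hlt
  have hu1 : 1 < u / t := (one_lt_div ht0).2 htu
  have hP : auxP e (u / t) = auxP e (l / t) := by
    unfold auxP
    rw [show 3 * e + 2 = (3 * e + 1) + 1 by ring,
      Real.rpow_add_one' (show 0 ≤ u / t by positivity) (show 3 * e + 1 + 1 ≠ 0 by linarith),
      Real.rpow_add_one' (show 0 ≤ l / t by positivity) (show 3 * e + 1 + 1 ≠ 0 by linarith),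
      Real.div_rpow hu0.le ht0.le, Real.div_rpow hl ht0.le]
    have e1 : (u ^ (3 * e + 1) * u - l ^ (3 * e + 1) * l) / (t ^ (3 * e + 1) * t)
        = (3 * e + 1 + 1) * (u - l) / t := by
      rw [← h, div_eq_div_iff (by positivity) (by positivity)]
      ring
    have e2 : ∀ z w : ℝ, w / t ^ (3 * e + 1) * (z / t) = w * z / (t ^ (3 * e + 1) * t) := by
      intro z w
      rw [div_mul_div_comm]
    rw [e2, e2]
    have e3 : (u ^ (3 * e + 1) * u - l ^ (3 * e + 1) * l) / (t ^ (3 * e + 1) * t) =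
      u ^ (3 * e + 1) * u / (t ^ (3 * e + 1) * t) - l ^ (3 * e + 1) * l / (t ^ (3 * e + 1) * t) :=
      sub_div _ _ _
    have e4 : (3 * e + 1 + 1) * (u - l) / t
      = (3 * e + 1 + 1) * (u / t) - (3 * e + 1 + 1) * (l / t) := by ring
    linarith
  have := step1 he (by positivity) hl1 hu1 hP
  rw [auxK_eq hl1.ne, auxK_eq hu1.ne', Real.div_rpow hu0.le ht0.le, Real.div_rpow hl ht0.le] at this
  unfold auxH
  set L := l ^ (3 * e + 1)
  set U := u ^ (3 * e + 1)
  set T := t ^ (3 * e + 1)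
  have k1 : L / T * (l / t - 1) / (L / T - 1) = L * (t - l) / (T - L) / t := by
    have : T - L ≠ 0 := by linarith
    have : L - T ≠ 0 := by linarith
    have : L / T - 1 ≠ 0 := by
      intro h'
      field_simp at h'
      exact this (by linarith)
    field_simp
    ring
  have k2 : U / T * (u / t - 1) / (U / T - 1) = U * (u - t) / (U - T) / t := by
    have : U - T ≠ 0 := by linarith
    have : U / T - 1 ≠ 0 := by
      intro h'
      field_simp at h'
      exact this (by linarith)
    field_simp
  rw [k1, k2, ← add_div, lt_div_iff₀ ht0] at this
  have : 2 / (3 * e + 1) * t = 2 * t / (3 * e + 1) := by ring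
  linarith

lemma auxH_upper {l u q m : ℝ} (hl : 0 ≤ l) (hq : 1 < q) (hlm : l < m) (hmu : m < u)
    (h : (q + 1) * m * (u ^ q - l ^ q) = q * (u ^ q * u - l ^ q * l))
    (hmid : m ^ q < (u ^ q + l ^ q) / 2) : auxH l u q m < 0 := by
  have hm0 : 0 < m := by linarith
  have hq0 : 0 < q := by linarith
  have h1 := Real.rpow_lt_rpow hl hlm hq0
  have h2 := Real.rpow_lt_rpow hm0.le hmu hq0
  have hy := young_strict q l m hq hl hm0.le hlm.ne
  unfold auxH
  set L := l ^ q
  set U := u ^ q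
  set T := m ^ q
  have hT : 0 < T - L := by linarith
  have hU : 0 < U - T := by linarith
  have e1 : L * (m - l) / (T - L) + U * (u - m) / (U - T) - 2 * m / q =
    ((U - T) - (T - L)) * ((q + 1) * m * L - q * (L * l) - T * m) / (q * (T - L) * (U - T)) := by
    field_simp
    linear_combination (T - L) * (-1) * h
  rw [e1]
  apply div_neg_of_neg_of_pos
  · apply mul_neg_of_pos_of_neg <;> linarith
  · positivity

lemma auxH_crit {l u p t : ℝ} (hl : 0 ≤ l) (hp : 2 < p) (ht : t ∈ Ioo l u)
    (hmin : ∀ s ∈ Ioo l u, V1 l u p t ≤ V1 l u p s) : auxH l u (p - 1) t = 0 := by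
  obtain ⟨hlt, htu⟩ := ht
  have ht0 : 0 < t := by linarith
  have hu0 : 0 < u := by linarith
  have hq0 : 0 < p - 1 := by linarith
  have h1 := Real.rpow_lt_rpow hl hlt hq0
  have h2 := Real.rpow_lt_rpow ht0.le htu hq0
  have hy1 := young_strict (p - 1) l t (by linarith) hl ht0.le hlt.ne
  have hy2 := young_strict (p - 1) u t (by linarith) hu0.le ht0.le htu.ne'
  have hloc : IsLocalMin (V1 l u p) t := by
    filter_upwards [Ioo_mem_nhds hlt htu] with s hs
    exact hmin s hs
  have dT := Real.hasDerivAt_rpow_const (x := t) (p := p - 1) (Or.inl ht0.ne')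
  have dA := ((dT.const_mul (l ^ (p - 1))).mul (((hasDerivAt_id t).sub_const l).pow 2)).div
    (dT.sub_const (l ^ (p - 1))) (sub_pos.2 h1).ne'
  have dB := ((dT.mul_const (u ^ (p - 1))).mul (((hasDerivAt_id t).const_sub u).pow 2)).div
    (dT.const_sub (u ^ (p - 1))) (sub_pos.2 h2).ne'
  have dV := (((dA.add dB).const_mul (-((p - 1) ^ 2 / (6 * p)))).add_const
    ((p - 1) / (6 * p) * (u ^ (p + 1) - l ^ (p + 1)))).sub_const (1 / 6 * (u ^ p * l - u * l ^ p))
  have h0 := hloc.hasDerivAt_eq_zero (f := V1 l u p) dV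
  have hc : -((p - 1) ^ 2 / (6 * p)) ≠ 0 := by
    have : 0 < (p - 1) ^ 2 / (6 * p) := by positivity
    linarith
  have h0 := (mul_eq_zero.1 h0).resolve_left hc
  have eT : t ^ (p - 1 - 1) = t ^ (p - 1) / t := by rw [Real.rpow_sub_one ht0.ne']
  have hT : 0 < t ^ (p - 1) := Real.rpow_pos_of_pos ht0 _
  unfold auxH
  simp only [Pi.pow_apply, Pi.mul_apply, id, eT] at h0
  set q := p - 1
  set L := l ^ q
  set U := u ^ q
  set T := t ^ q
  have hTL : 0 < T - L := by linarith
  have hUT : 0 < U - T := by linarith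
  set a := L * (t - l) / (T - L) with ha
  set b := U * (u - t) / (U - T) with hb
  have a1 : a < t / q := by
    rw [ha, div_lt_div_iff₀ hTL hq0]; linarith
  have b1 : t / q < b := by
    rw [hb, div_lt_div_iff₀ hq0 hUT]; linarith
  have h00 : (a - b) * (2 * T - q * (T / t) * (a + b)) = 0 := by
    rw [← h0, ha, hb]
    field_simp
    ring
  have h01 := (mul_eq_zero.1 h00).resolve_left (by linarith)
  have h02 : T * (2 * t - q * (a + b)) = 0 := by
    have : T * (2 * t - q * (a + b)) = t * (2 * T - q * (T / t) * (a + b)) := by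
      field_simp
    rw [this, h01, mul_zero]
  have h03 := (mul_eq_zero.1 h02).resolve_left hT.ne'
  have : a + b = 2 * t / q := by
    rw [eq_div_iff hq0.ne']
    linarith
  linarith

/-- Bounds on the minimizer of `ξ₁ ↦ V_p(ℓ, ξ₁, u)` for `p > 2`:
`((u^{p−1}+ℓ^{p−1})/2)^{1/(p−1)} > (p−1)(uᵖ−ℓᵖ)/(p(u^{p−1}−ℓ^{p−1})) > ξ₁*
  > ((uᵖ−ℓᵖ)/(p(u−ℓ)))^{1/(p−1)} > (u+ℓ)/2`. -/
theorem minimizer_bounds_of_two_lt_p (l u : ℝ) (hl : 0 ≤ l) (hlu : l < u)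
    (p : ℝ) (hp : 2 < p)
    (xstar : ℝ) (hx : xstar ∈ Set.Ioo l u)
    (hmin : ∀ t ∈ Set.Ioo l u, V1 l u p xstar ≤ V1 l u p t) :
    (p - 1) * (u ^ p - l ^ p) / (p * (u ^ (p - 1) - l ^ (p - 1)))
        < ((u ^ (p - 1) + l ^ (p - 1)) / 2) ^ (1 / (p - 1)) ∧
    xstar < (p - 1) * (u ^ p - l ^ p) / (p * (u ^ (p - 1) - l ^ (p - 1))) ∧
    ((u ^ p - l ^ p) / (p * (u - l))) ^ (1 / (p - 1)) < xstar ∧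
    (u + l) / 2 < ((u ^ p - l ^ p) / (p * (u - l))) ^ (1 / (p - 1)) := by
  have hcrit := auxH_crit hl hp hx hmin
  obtain ⟨q, rfl⟩ : ∃ q, p = q + 1 := ⟨p - 1, by ring⟩
  rw [show q + 1 - 1 = q by ring] at *
  have hq : 1 < q := by linarith
  have hq0 : 0 < q := by linarith
  have hu0 : 0 < u := by linarith
  have hLU := Real.rpow_lt_rpow hl hlu hq0
  have hL0 : 0 ≤ l ^ q := Real.rpow_nonneg hl q
  have hU0 : 0 < u ^ q := by linarith
  have eu : u ^ (q + 1) = u ^ q * u := Real.rpow_add_one' hu0.le (by linarith)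
  have el : l ^ (q + 1) = l ^ q * l := Real.rpow_add_one' hl (by linarith)
  -- first inequality
  have ineq1 : q * (u ^ (q + 1) - l ^ (q + 1)) / ((q + 1) * (u ^ q - l ^ q))
      < ((u ^ q + l ^ q) / 2) ^ (1 / q) := by
    have hh := hermite_hadamard (l ^ q) (u ^ q) hLU (fun y => -(q / (q + 1) * y ^ (1 / q + 1)))
      (-fun y => y ^ (1 / q)) ?_ ?_
    · have r : ∀ z : ℝ, 0 ≤ z → (z ^ q) ^ (1 / q + 1) = z ^ (q + 1) := by
        intro z hz
        rw [← Real.rpow_mul hz]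
        congr 1
        field_simp
        ring
      simp only [Pi.neg_apply] at hh
      rw [r u hu0.le, r l hl, add_comm (l ^ q)] at hh
      rw [div_lt_iff₀ (mul_pos (by linarith) (by linarith))]
      have e : q * (u ^ (q + 1) - l ^ (q + 1)) =
        (q + 1) * (q / (q + 1) * u ^ (q + 1) - q / (q + 1) * l ^ (q + 1)) := by field_simp
      rw [e, mul_left_comm]
      apply mul_lt_mul_of_pos_left _ (by linarith)
      linarith
    · intro y hy
      have := ((Real.hasDerivAt_rpow_const (x := y) (p := 1 / q + 1)
        (Or.inr (by have : 0 < 1 / q := by positivity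
                    linarith))).const_mul (q / (q + 1))).neg
      refine this.congr_deriv ?_
      rw [add_sub_cancel_right]
      simp only [Pi.neg_apply]
      field_simp
      ring
    · apply StrictConcaveOn.neg
      refine (Real.strictConcaveOn_rpow (by positivity) ?_).subset ?_ (convex_Icc _ _)
      · rw [div_lt_one hq0]; exact hq
      · intro y hy
        exact le_trans hL0 hy.1
  -- fourth inequality
  have ineq4' : ((u + l) / 2) ^ q < (u ^ (q + 1) - l ^ (q + 1)) / ((q + 1) * (u - l)) := by
    have hh := hermite_hadamard l u hlu (fun y => 1 / (q + 1) * y ^ (q + 1)) (fun y => y ^ q) ?_ ?_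
    · simp only [add_comm l u] at hh
      rw [lt_div_iff₀ (mul_pos (by linarith) (by linarith))]
      have e : (u ^ (q + 1) - l ^ (q + 1)) =
        (q + 1) * (1 / (q + 1) * u ^ (q + 1) - 1 / (q + 1) * l ^ (q + 1)) := by field_simp
      rw [e, mul_left_comm]
      apply mul_lt_mul_of_pos_left _ (by linarith)
      linarith
    · intro y hy
      have := ((Real.hasDerivAt_rpow_const (x := y) (p := q + 1)
        (Or.inr (by linarith))).const_mul (1 / (q + 1)))
      refine this.congr_deriv ?_
      rw [add_sub_cancel_right]
      field_simp
    · exact (strictConvexOn_rpow hq).subset (fun y hy => le_trans hl hy.1) (convex_Icc _ _)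
  have hmid0 : 0 ≤ (u + l) / 2 := by linarith
  have hM0 : 0 ≤ (u ^ (q + 1) - l ^ (q + 1)) / ((q + 1) * (u - l)) :=
    le_trans (Real.rpow_nonneg hmid0 q) ineq4'.le
  have ineq4 : (u + l) / 2 < ((u ^ (q + 1) - l ^ (q + 1)) / ((q + 1) * (u - l))) ^ (1 / q) := by
    have := Real.rpow_lt_rpow (Real.rpow_nonneg hmid0 q) ineq4' (show 0 < 1 / q by positivity)
    rwa [one_div, Real.rpow_rpow_inv hmid0 hq0.ne', ← one_div] at this
  refine ⟨ineq1, ?_, ?_, ineq4⟩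
  · set m := q * (u ^ (q + 1) - l ^ (q + 1)) / ((q + 1) * (u ^ q - l ^ q)) with hm
    by_contra! hcon
    have hden : 0 < (q + 1) * (u ^ q - l ^ q) := mul_pos (by linarith) (by linarith)
    have hlm : l < m := by
      have := young_strict q u l hq hu0.le hl hlu.ne'
      rw [hm, lt_div_iff₀ hden, eu, el]
      linarith
    have hmu : m < u := lt_of_le_of_lt hcon hx.2
    have hm0 : 0 ≤ m := by linarith
    have h1 : (q + 1) * m * (u ^ q - l ^ q) = q * (u ^ q * u - l ^ q * l) := by
      rw [← eu, ← el, hm]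
      field_simp [hden.ne', (sub_pos.2 hLU).ne']
    have h2 : m ^ q < (u ^ q + l ^ q) / 2 := by
      have := Real.rpow_lt_rpow hm0 ineq1 hq0
      rwa [one_div, Real.rpow_inv_rpow (by linarith) hq0.ne'] at this
    have hneg := auxH_upper hl hq hlm hmu h1 h2
    rcases hcon.eq_or_lt with h | h
    · rw [h] at hneg; linarith
    · have := auxH_anti hl hq hlm h hx.2
      linarith
  · set t := ((u ^ (q + 1) - l ^ (q + 1)) / ((q + 1) * (u - l))) ^ (1 / q) with ht
    by_contra! hcon
    have hden : 0 < (q + 1) * (u - l) := mul_pos (by linarith) (by linarith)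
    have hT : t ^ q = (u ^ (q + 1) - l ^ (q + 1)) / ((q + 1) * (u - l)) := by
      rw [ht, one_div, Real.rpow_inv_rpow hM0 hq0.ne']
    have hlt : l < t := by linarith
    have htu : t < u := by
      have := young_strict q u l hq hu0.le hl hlu.ne'
      rw [← Real.rpow_lt_rpow_iff (by linarith) hu0.le hq0, hT, div_lt_iff₀ hden, eu, el]
      linarith
    have h1 : (q + 1) * t ^ q * (u - l) = u ^ q * u - l ^ q * l := by
      rw [← eu, ← el, hT]
      field_simp [hden.ne', (sub_pos.2 hlu).ne']
    have hpos := auxH_lower hl hq hlt htu h1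
    rcases hcon.eq_or_lt with h | h
    · rw [← h] at hpos; linarith
    · have := auxH_anti hl hq hx.1 h htu
      linarith
end

section
/- (i) If 1 < p < 2, then the function t ↦ Δ(p, t) is strictly decreasing on [0, 1), and 0 < Δ(p, t) ≤ Δ(p, 0) for all t ∈ [0, 1). (ii) If p > 2, then the function t ↦ (1−t)·Δ(p, t) is strictly increasing on [0, 1), and Δ(p, 0) ≤ (1−t)·Δ(p, t) < 0 for all t ∈ [0, 1). -/
/-- The normalized gap `Δ(p, t)` between the upper and lower bounds on the optimal
single linearization point, with `t = ℓ/u`. -/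
noncomputable def Dgap (p t : ℝ) : ℝ :=
  (1 / (1 - t)) * (((1 - t ^ p) / (p * (1 - t))) ^ (1 / (p - 1))
    - (p - 1) * (1 - t ^ p) / (p * (1 - t ^ (p - 1))))


lemma polyI_core (x d C : ℝ) (hx : 0 < x) (hd : 0 < d) (hC : 0 < C)
    (h : C = x ^ 2 + x ^ 3 - d * (3 / 2 + d / 2 + 2 * x)) :
    0 < (3 * (1 + x) ^ 3 * x * (x + d) - (2 * (1 + x) - 1) * (x + d) * C + (1 + x) * x * C)
        * ((1 + x) ^ 2 * (x + d) + C)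
      - (1 + x) ^ 2 * (1 + x + (x + d)) * (x + (x + d)) * x
        * (C + (1 + x + (x + d) + 1 / 2) * (x + d)) := by
  have key : (3 * (1 + x) ^ 3 * x * (x + d) - (2 * (1 + x) - 1) * (x + d) * C + (1 + x) * x * C)
        * ((1 + x) ^ 2 * (x + d) + C)
      - (1 + x) ^ 2 * (1 + x + (x + d)) * (x + (x + d)) * x
        * (C + (1 + x + (x + d) + 1 / 2) * (x + d))
      = d * (C * (x ^ 2 * (1 + 2 * x) + d * (5 * x ^ 2 + 5 * x + 1) + d ^ 2 * (1 + x))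
        + d * x ^ 2 / 4
        + d ^ 2 * (3 / 4 + 11 / 2 * x + 10 * x ^ 2 + 15 / 2 * x ^ 3 + 2 * x ^ 4)
        + d ^ 3 * (1 + 5 / 2 * x + 7 / 4 * x ^ 2 + x ^ 3 / 2) + d ^ 4 * (1 / 4)) := by
    subst h
    ring
  rw [key]
  positivity

lemma polyI (a b r : ℝ) (ha : 0 < a) (ha1 : a < 1) (hb : 1 < b) (hr : b < r)
    (h : a * b * (b - 1) * (r - b) = b ^ 3 - r * (r + 1) / 2) :
    r * (r - 1) * (a * b * (b - 1) + r + 1 / 2)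
      < (3 * b ^ 2 + a * (3 * b ^ 2 - 2 * b) - a * (2 * b - 1) * r) * (r - b)
        * (b + a * (b - 1)) := by
  obtain ⟨x, rfl⟩ : ∃ x, b = 1 + x := ⟨b - 1, by ring⟩
  obtain ⟨y, rfl⟩ : ∃ y, r = 1 + x + y := ⟨r - (1 + x), by ring⟩
  have hx : 0 < x := by linarith
  have hy : 0 < y := by linarith
  have hxy : x < y := by
    by_contra hcon
    push Not at hcon
    have h1 : 0 < (1 - a) * ((1 + x) * x * y) := by
      have : 0 < 1 - a := by linarith
      positivity
    have h2 : 0 ≤ (x - y) * (3 / 2 + (5 * x + y) / 2 + x ^ 2) := by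
      have : 0 ≤ x - y := by linarith
      positivity
    nlinarith
  obtain ⟨d, rfl⟩ : ∃ d, y = x + d := ⟨y - x, by ring⟩
  have hd : 0 < d := by linarith
  have := polyI_core x d (a * (1 + x) * x * (x + d)) hx hd (by positivity) (by linarith)
  have e : 0 < ((1 + x) ^ 2 * x * (x + d)) * ((3 * (1 + x) ^ 2 + a * (3 * (1 + x) ^ 2 - 2 * (1 + x)) - a * (2 * (1 + x) - 1) * (1 + x + (x + d))) * (1 + x + (x + d) - (1 + x))
        * (1 + x + a * (1 + x - 1)) - (1 + x + (x + d)) * (1 + x + (x + d) - 1) * (a * (1 + x) * (1 + x - 1) + (1 + x + (x + d)) + 1 / 2)) := by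
    refine this.trans_eq ?_
    ring
  have := (pos_iff_pos_of_mul_pos e).1 (by positivity)
  linarith

lemma polyII_core (y d C : ℝ) (hy : 0 < y) (hd : 0 < d)
    (h : C = (1 + (y + d)) ^ 2 * (y + d) - (1 + (y + d) + y + 1) * y / 2) :
    0 < (1 + (y + d)) ^ 2 * (1 + (y + d) + y) * ((y + d) + y) * (y + d)
          * (C + (1 + (y + d) + y + y + 1) * y / 2)
        - ((2 * (1 + (y + d)) * (y + d) + (1 + (y + d)) ^ 2 + (1 + (y + d) + y + 1) / 2)
            * (1 + (y + d)) * (y + d) * y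
            - (2 * (1 + (y + d)) - 1) * y * C + (1 + (y + d)) * (y + d) * C)
          * ((1 + (y + d)) ^ 2 * y + C) := by
  subst h
  ring_nf
  positivity

lemma polyII (a b r : ℝ) (ha1 : 1 < a) (hb : 1 < b) (hr : b < r)
    (h : a * b * (b - 1) * (r - b) = b ^ 2 * (b - 1) - (r + 1) * (r - b) / 2) :
    (1 / 2 + b * (b - 1) * 2 + b ^ 2 + a * (3 * b ^ 2 - 2 * b) - (-1 / 2 + a * (2 * b - 1)) * r)
        * (r - b) * (b + a * (b - 1))
      < r * (r - 1) * (r + (1 / 2 - b / 2 + a * b * (b - 1))) := by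
  obtain ⟨x, rfl⟩ : ∃ x, b = 1 + x := ⟨b - 1, by ring⟩
  obtain ⟨y, rfl⟩ : ∃ y, r = 1 + x + y := ⟨r - (1 + x), by ring⟩
  have hx : 0 < x := by linarith
  have hy : 0 < y := by linarith
  have hxy : y < x := by
    by_contra hcon
    push Not at hcon
    have h1 : 0 < (a - 1) * ((1 + x) * x * y) := by
      have : 0 < a - 1 := by linarith
      positivity
    have h2 : 0 ≤ (y - x) * (1 + x ^ 2 + (4 * x + y) / 2) := by
      have : 0 ≤ y - x := by linarith
      positivity
    nlinarith
  obtain ⟨d, rfl⟩ : ∃ d, x = y + d := ⟨x - y, by ring⟩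
  have hd : 0 < d := by linarith
  have := polyII_core y d (a * (1 + (y + d)) * (y + d) * y) hy hd (by linarith)
  have e : 0 < ((1 + (y + d)) ^ 2 * (y + d) * y) * ((1 + (y + d) + y) * (1 + (y + d) + y - 1) * (1 + (y + d) + y + (1 / 2 - (1 + (y + d)) / 2 + a * (1 + (y + d)) * (1 + (y + d) - 1)))
    - (1 / 2 + (1 + (y + d)) * (1 + (y + d) - 1) * 2 + (1 + (y + d)) ^ 2 + a * (3 * (1 + (y + d)) ^ 2 - 2 * (1 + (y + d))) - (-1 / 2 + a * (2 * (1 + (y + d)) - 1)) * (1 + (y + d) + y))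
        * (1 + (y + d) + y - (1 + (y + d))) * (1 + (y + d) + a * (1 + (y + d) - 1))) := by
    refine this.trans_eq ?_
    ring
  have := (pos_iff_pos_of_mul_pos e).1 (by positivity)
  linarith


/-- Logarithmic defect along a trial curve `b ↦ ρ b`. -/
noncomputable def Ldef (a : ℝ) (ρ : ℝ → ℝ) (b : ℝ) : ℝ :=
  Real.log (b + a * (b - 1)) - Real.log (b - a * (ρ b - b)) - a * Real.log (ρ b)

lemma Ldef_hasDerivAt (a b ρ' : ℝ) (ρ : ℝ → ℝ) (hρ : HasDerivAt ρ ρ' b)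
    (h1 : 0 < b + a * (b - 1)) (h2 : 0 < b - a * (ρ b - b)) (h3 : 0 < ρ b) :
    HasDerivAt (Ldef a ρ)
      (a * (1 + a) / (b - a * (ρ b - b)) *
        (ρ' * (ρ b - b) / ρ b - (ρ b - 1) / (b + a * (b - 1)))) b := by
  have i := hasDerivAt_id b
  have e1 := ((i.add ((i.sub_const 1).const_mul a)).log h1.ne')
  have e2 := ((i.sub ((hρ.sub i).const_mul a)).log h2.ne')
  have e3 := ((hρ.log h3.ne').const_mul a)
  have e := (e1.sub e2).sub e3
  refine e.congr_deriv ?_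
  simp only [Pi.add_apply, Pi.sub_apply, id]
  field_simp
  ring

lemma root_hasDerivAt (q c : ℝ → ℝ) (q' c' b : ℝ) (hq : HasDerivAt q q' b)
    (hc : HasDerivAt c c' b) (hpos : 0 < q b ^ 2 + 2 * c b) :
    HasDerivAt (fun z => -q z + √(q z ^ 2 + 2 * c z))
      ((c' - q' * (-q b + √(q b ^ 2 + 2 * c b))) / √(q b ^ 2 + 2 * c b)) b := by
  have hS := Real.sqrt_pos.2 hpos
  have e := hq.neg.add (((hq.pow 2).add (hc.const_mul 2)).sqrt hpos.ne')
  refine e.congr_deriv ?_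
  simp only [Pi.add_apply, Pi.pow_apply]
  field_simp
  ring

lemma psi_anti (a b u v : ℝ) (ha : 0 < a) (hb : 0 < b) (hu : b ≤ u) (huv : u ≤ v) :
    v ^ a * (b * (1 + a) - a * v) ≤ u ^ a * (b * (1 + a) - a * u) := by
  have : AntitoneOn (fun z : ℝ => z ^ a * (b * (1 + a) - a * z)) (Set.Ici b) := by
    have hd : ∀ z ∈ Set.Ici b, HasDerivAt (fun z : ℝ => z ^ a * (b * (1 + a) - a * z))
        (a * (1 + a) * z ^ (a - 1) * (b - z)) z := by
      intro z hz
      have hz0 : 0 < z := lt_of_lt_of_le hb hz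
      have e := (Real.hasDerivAt_rpow_const (x := z) (p := a) (Or.inl hz0.ne')).mul
        (((hasDerivAt_id z).const_mul a).const_sub (b * (1 + a)))
      refine e.congr_deriv ?_
      have : z ^ a = z ^ (a - 1) * z := by
        rw [Real.rpow_sub_one hz0.ne']; field_simp
      simp only [id]
      rw [this]; ring
    apply antitoneOn_of_deriv_nonpos (convex_Ici b)
    · exact fun z hz => (hd z hz).continuousAt.continuousWithinAt
    · exact fun z hz => (hd z (interior_subset hz)).differentiableAt.differentiableWithinAt
    · intro z hz
      rw [(hd z (interior_subset hz)).deriv]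
      have hz' : b ≤ z := interior_subset hz
      have : 0 < z := lt_of_lt_of_le hb hz'
      have h2 : 0 ≤ z - b := by linarith
      have h3 : 0 ≤ a * (1 + a) * z ^ (a - 1) * (z - b) := by positivity
      linarith
  exact this hu (hu.trans huv) huv

lemma psi_anti_lt (a b u v : ℝ) (ha : 0 < a) (hb : 0 < b) (hv : b ≤ v)
    (h : u ^ a * (b * (1 + a) - a * u) > v ^ a * (b * (1 + a) - a * v)) : u < v := by
  by_contra hc
  push Not at hc
  have := psi_anti a b v u ha hb hv hc
  linarith

lemma keyI (a b r : ℝ) (ha : 0 < a) (ha1 : a < 1) (hb : 1 < b) (hr : b < r)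
    (h : r ^ a * (b * (1 + a) - a * r) = b * (1 + a) - a) :
    r * (r + 1) / 2 < b ^ 2 + b * (b - 1) * (b - a * (r - b)) := by
  let q : ℝ → ℝ := fun b => 1 / 2 + a * b * (b - 1)
  let c : ℝ → ℝ := fun b => b ^ 3 + a * b ^ 2 * (b - 1)
  let ρ : ℝ → ℝ := fun z => -q z + √(q z ^ 2 + 2 * c z)
  have hcpos : ∀ z, 1 ≤ z → 0 < c z := by
    intro z hz
    have : 0 ≤ z - 1 := by linarith
    simp only [c]; positivity
  have hpos : ∀ z, 1 ≤ z → 0 < q z ^ 2 + 2 * c z := fun z hz => by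
    have := hcpos z hz; positivity
  have hq : ∀ z, HasDerivAt q (a * (2 * z - 1)) z := by
    intro z
    have i := hasDerivAt_id z
    refine (((i.const_mul a).mul (i.sub_const 1)).const_add (1 / 2)).congr_deriv ?_
    simp only [id]; ring
  have hc : ∀ z, HasDerivAt c (3 * z ^ 2 + a * (3 * z ^ 2 - 2 * z)) z := by
    intro z
    have i := hasDerivAt_id z
    refine ((i.pow 3).add ((((i.pow 2).const_mul a).mul (i.sub_const 1)))).congr_deriv ?_
    simp only [id, Pi.pow_apply]; norm_num; ring
  have hρ : ∀ z, 1 ≤ z → HasDerivAt ρ _ z := fun z hz =>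
    root_hasDerivAt q c _ _ z (hq z) (hc z) (hpos z hz)
  have hS : ∀ z, √(q z ^ 2 + 2 * c z) = ρ z + q z := fun z => by simp only [ρ]; ring
  have hSq : ∀ z, 1 ≤ z → ρ z ^ 2 + 2 * ρ z * q z = 2 * c z := by
    intro z hz
    have := Real.sq_sqrt (hpos z hz).le
    rw [hS] at this
    linarith
  have hgt : ∀ z, 1 < z → z < ρ z := by
    intro z hz
    have : z + q z < √(q z ^ 2 + 2 * c z) := by
      apply Real.lt_sqrt_of_sq_lt
      simp only [q, c]
      nlinarith [mul_pos (by linarith : (0:ℝ) < z) (by linarith : 0 < z - 1),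
        mul_pos (mul_pos (by linarith : (0:ℝ) < z) (by linarith : 0 < z - 1)) (by linarith : 0 < z)]
    rw [hS] at this
    linarith
  have hone : ρ 1 = 1 := by
    have h0 : q 1 ^ 2 + 2 * c 1 = (3 / 2 : ℝ) ^ 2 := by simp only [q, c]; norm_num
    simp only [ρ]
    rw [h0, Real.sqrt_sq (by norm_num)]
    simp only [q]; norm_num
  have hD : ∀ z, 1 ≤ z → 0 < z - a * (ρ z - z) := by
    intro z hz
    rcases hz.eq_or_lt with rfl | hz
    · rw [hone]; norm_num
    · have h1 := hSq z hz.le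
      have h2 := hgt z hz
      have h3 : 0 < z * (z - 1) := mul_pos (by linarith) (by linarith)
      have h4 : z * (z - 1) * (z - a * (ρ z - z)) = ρ z * (ρ z + 1) / 2 - z ^ 2 := by
        simp only [q, c] at h1
        linear_combination (-1 / 2) * h1
      by_contra hcon
      push Not at hcon
      have h5 : z * (z - 1) * (z - a * (ρ z - z)) ≤ 0 := mul_nonpos_of_nonneg_of_nonpos h3.le hcon
      have h6 : 0 < (1 - a) * (ρ z - z) := mul_pos (by linarith) (by linarith)
      have h7 : 2 * z < ρ z := by linarith
      nlinarith
  have hpos1 : ∀ z, 1 ≤ z → 0 < z + a * (z - 1) := by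
    intro z hz
    have : 0 ≤ z - 1 := by linarith
    positivity
  have hρpos : ∀ z, 1 ≤ z → 0 < ρ z := by
    intro z hz
    rcases hz.eq_or_lt with rfl | hz
    · rw [hone]; norm_num
    · linarith [hgt z hz]
  have hL : ∀ z, 1 ≤ z → HasDerivAt (Ldef a ρ) _ z := fun z hz =>
    Ldef_hasDerivAt a z _ ρ (hρ z hz) (hpos1 z hz) (hD z hz) (hρpos z hz)
  have hmono : StrictMonoOn (Ldef a ρ) (Set.Icc 1 b) := by
    apply strictMonoOn_of_deriv_pos (convex_Icc 1 b)
    · exact fun z hz => (hL z hz.1).continuousAt.continuousWithinAt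
    · intro z hz
      rw [interior_Icc] at hz
      rw [(hL z hz.1.le).deriv]
      have d := hD z hz.1.le
      refine mul_pos (by positivity) ?_
      have g := hgt z hz.1
      have s1 := hSq z hz.1.le
      have pp := polyI a z (ρ z) ha ha1 hz.1 g (by
        simp only [q, c] at s1
        linear_combination (1 / 2) * s1)
      have p1 := hpos1 z hz.1.le
      have p2 := hρpos z hz.1.le
      have sp := Real.sqrt_pos.2 (hpos z hz.1.le)
      change 0 < _ / √(q z ^ 2 + 2 * c z) * (ρ z - z) / ρ z - _
      rw [sub_pos, div_mul_eq_mul_div, div_div, div_lt_div_iff₀ p1 (by positivity)]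
      rw [hS]
      have hh : -q z + (ρ z + q z) = ρ z := by ring
      rw [hh]
      simp only [q]
      linarith
  have hLb := hmono (Set.left_mem_Icc.2 hb.le) (Set.right_mem_Icc.2 hb.le) hb
  have hL1 : Ldef a ρ 1 = 0 := by simp [Ldef, hone]
  rw [hL1] at hLb
  have hb' := hgt b hb
  have hlt : r < ρ b := by
    apply psi_anti_lt a b r (ρ b) ha (by linarith) hb'.le
    rw [h]
    have d := hD b hb.le
    have e := hρpos b hb.le
    have f := hpos1 b hb.le
    have : Real.log (ρ b ^ a * (b - a * (ρ b - b))) < Real.log (b + a * (b - 1)) := by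
      rw [Real.log_mul (by positivity) d.ne', Real.log_rpow e]
      simp only [Ldef] at hLb
      linarith
    have := (Real.log_lt_log_iff (by positivity) f).1 this
    have e1 : b * (1 + a) - a * ρ b = b - a * (ρ b - b) := by ring
    rw [e1]
    linarith
  have s1 := hSq b hb.le
  simp only [q, c] at s1
  have : 0 < (ρ b - r) * ((ρ b + r) / 2 + 1 / 2 + a * b * (b - 1)) := by
    have h1 : 0 < b - 1 := by linarith
    have h2 : 0 < ρ b - r := by linarith
    have h3 : 0 < b := by linarith
    have h4 : 0 < r := by linarith
    have h5 : 0 < ρ b := by linarith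
    positivity
  nlinarith

lemma keyII (a b r : ℝ) (ha1 : 1 < a) (hb : 1 < b) (hr : b < r)
    (h : r ^ a * (b * (1 + a) - a * r) = b * (1 + a) - a) :
    b * (b - 1) * (b - a * (r - b)) < (r + 1) / 2 * (r - b) := by
  have ha : 0 < a := by linarith
  let q : ℝ → ℝ := fun b => 1 / 2 - b / 2 + a * b * (b - 1)
  let c : ℝ → ℝ := fun b => b / 2 + b ^ 2 * (b - 1) + a * b ^ 2 * (b - 1)
  let ρ : ℝ → ℝ := fun z => -q z + √(q z ^ 2 + 2 * c z)
  have hcpos : ∀ z, 1 ≤ z → 0 < c z := by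
    intro z hz
    have : 0 ≤ z - 1 := by linarith
    simp only [c]; positivity
  have hpos : ∀ z, 1 ≤ z → 0 < q z ^ 2 + 2 * c z := fun z hz => by
    have := hcpos z hz; positivity
  have hq : ∀ z, HasDerivAt q (-1 / 2 + a * (2 * z - 1)) z := by
    intro z
    have i := hasDerivAt_id z
    refine (((i.div_const 2).const_sub (1 / 2)).add
      ((i.const_mul a).mul (i.sub_const 1))).congr_deriv ?_
    simp only [id]; ring
  have hc : ∀ z, HasDerivAt c
      (1 / 2 + z * (z - 1) * 2 + z ^ 2 + a * (3 * z ^ 2 - 2 * z)) z := by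
    intro z
    have i := hasDerivAt_id z
    refine (((i.div_const 2).add ((i.pow 2).mul (i.sub_const 1))).add
      ((((i.pow 2).const_mul a).mul (i.sub_const 1)))).congr_deriv ?_
    simp only [id, Pi.pow_apply]; norm_num; ring
  have hρ : ∀ z, 1 ≤ z → HasDerivAt ρ _ z := fun z hz =>
    root_hasDerivAt q c _ _ z (hq z) (hc z) (hpos z hz)
  have hS : ∀ z, √(q z ^ 2 + 2 * c z) = ρ z + q z := fun z => by simp only [ρ]; ring
  have hSq : ∀ z, 1 ≤ z → ρ z ^ 2 + 2 * ρ z * q z = 2 * c z := by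
    intro z hz
    have := Real.sq_sqrt (hpos z hz).le
    rw [hS] at this
    linarith
  have hgt : ∀ z, 1 < z → z < ρ z := by
    intro z hz
    have : z + q z < √(q z ^ 2 + 2 * c z) := by
      apply Real.lt_sqrt_of_sq_lt
      simp only [q, c]
      nlinarith [mul_pos (mul_pos (by linarith : (0:ℝ) < z) (by linarith : 0 < z - 1)) (by linarith : 0 < z)]
    rw [hS] at this
    linarith
  have hone : ρ 1 = 1 := by
    have h0 : q 1 ^ 2 + 2 * c 1 = (1 : ℝ) ^ 2 := by simp only [q, c]; norm_num
    simp only [ρ]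
    rw [h0, Real.sqrt_sq (by norm_num)]
    simp only [q]; norm_num
  have hD : ∀ z, 1 ≤ z → 0 < z - a * (ρ z - z) := by
    intro z hz
    rcases hz.eq_or_lt with rfl | hz
    · rw [hone]; norm_num
    · have h1 := hSq z hz.le
      have h2 := hgt z hz
      have h3 : 0 < z * (z - 1) := mul_pos (by linarith) (by linarith)
      have h4 : z * (z - 1) * (z - a * (ρ z - z)) = (ρ z + 1) * (ρ z - z) / 2 := by
        simp only [q, c] at h1
        linear_combination (-1 / 2) * h1
      have h5 : 0 < (ρ z + 1) * (ρ z - z) / 2 := by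
        have h6 : 0 < ρ z - z := by linarith
        have h7 : 0 < ρ z + 1 := by linarith
        positivity
      rw [← h4] at h5
      exact (pos_iff_pos_of_mul_pos h5).1 h3
  have hpos1 : ∀ z, 1 ≤ z → 0 < z + a * (z - 1) := by
    intro z hz
    have : 0 ≤ z - 1 := by linarith
    positivity
  have hρpos : ∀ z, 1 ≤ z → 0 < ρ z := by
    intro z hz
    rcases hz.eq_or_lt with rfl | hz
    · rw [hone]; norm_num
    · linarith [hgt z hz]
  have hL : ∀ z, 1 ≤ z → HasDerivAt (Ldef a ρ) _ z := fun z hz =>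
    Ldef_hasDerivAt a z _ ρ (hρ z hz) (hpos1 z hz) (hD z hz) (hρpos z hz)
  have hmono : StrictAntiOn (Ldef a ρ) (Set.Icc 1 b) := by
    apply strictAntiOn_of_deriv_neg (convex_Icc 1 b)
    · exact fun z hz => (hL z hz.1).continuousAt.continuousWithinAt
    · intro z hz
      rw [interior_Icc] at hz
      rw [(hL z hz.1.le).deriv]
      have d := hD z hz.1.le
      refine mul_neg_of_pos_of_neg (by positivity) ?_
      have g := hgt z hz.1
      have s1 := hSq z hz.1.le
      have pp := polyII a z (ρ z) ha1 hz.1 g (by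
        simp only [q, c] at s1
        linear_combination (1 / 2) * s1)
      have p1 := hpos1 z hz.1.le
      have p2 := hρpos z hz.1.le
      have sp := Real.sqrt_pos.2 (hpos z hz.1.le)
      change _ / √(q z ^ 2 + 2 * c z) * (ρ z - z) / ρ z - _ < 0
      rw [sub_neg, div_mul_eq_mul_div, div_div, div_lt_div_iff₀ (by positivity) p1]
      rw [hS]
      have hh : -q z + (ρ z + q z) = ρ z := by ring
      rw [hh]
      simp only [q]
      linarith
  have hLb := hmono (Set.left_mem_Icc.2 hb.le) (Set.right_mem_Icc.2 hb.le) hb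
  have hL1 : Ldef a ρ 1 = 0 := by simp [Ldef, hone]
  rw [hL1] at hLb
  have hb' := hgt b hb
  have hlt : ρ b < r := by
    apply psi_anti_lt a b (ρ b) r ha (by linarith) hr.le
    rw [h]
    have d := hD b hb.le
    have e := hρpos b hb.le
    have f := hpos1 b hb.le
    have : Real.log (b + a * (b - 1)) < Real.log (ρ b ^ a * (b - a * (ρ b - b))) := by
      rw [Real.log_mul (by positivity) d.ne', Real.log_rpow e]
      simp only [Ldef] at hLb
      linarith
    have := (Real.log_lt_log_iff f (by positivity)).1 this
    have e1 : b * (1 + a) - a * ρ b = b - a * (ρ b - b) := by ring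
    rw [e1]
    linarith
  have s1 := hSq b hb.le
  simp only [q, c] at s1
  have : 0 < (r - ρ b) * ((ρ b + r) / 2 + (1 - b) / 2 + a * b * (b - 1)) := by
    have h1 : 0 < b - 1 := by linarith
    have h2 : 0 < r - ρ b := by linarith
    have h3 : 0 < b := by linarith
    have h4 : 0 < (ρ b + r) / 2 + (1 - b) / 2 := by linarith
    positivity
  nlinarith


lemma tangent_le (a z m : ℝ) (ha : 0 ≤ a) (ha1 : a ≤ 1) (hz : 0 < z) (hm : 0 < m) :
    z ^ a ≤ m ^ a * (1 + a * (z / m - 1)) := by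
  have hu : 0 < z / m := by positivity
  have h := rpow_one_add_le_one_add_mul_self (s := z / m - 1) (by linarith) ha ha1
  rw [add_sub_cancel, Real.div_rpow hz.le hm.le, div_le_iff₀ (by positivity)] at h
  linarith

lemma tangent_ge (a z m : ℝ) (ha1 : 1 ≤ a) (hz : 0 < z) (hm : 0 < m) :
    m ^ a * (1 + a * (z / m - 1)) ≤ z ^ a := by
  have hu : 0 < z / m := by positivity
  have h := one_add_mul_self_le_rpow_one_add (s := z / m - 1) (by linarith) ha1
  rw [add_sub_cancel, Real.div_rpow hz.le hm.le, le_div_iff₀ (by positivity)] at h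
  linarith

lemma tangent_neg (c u : ℝ) (hc : 0 ≤ c) (hu : 0 < u) : u ^ c * (1 - c * (u - 1)) ≤ 1 := by
  have h1 := Real.log_le_sub_one_of_pos hu
  have h2 := Real.add_one_le_exp (-(c * Real.log u))
  have h3 : 1 - c * (u - 1) ≤ Real.exp (-(c * Real.log u)) := by nlinarith
  have h4 : u ^ c = Real.exp (c * Real.log u) := by
    rw [Real.rpow_def_of_pos hu, mul_comm]
  calc u ^ c * (1 - c * (u - 1)) ≤ u ^ c * Real.exp (-(c * Real.log u)) := by gcongr
    _ = 1 := by rw [h4, ← Real.exp_add]; simp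

lemma mono_of_hasDeriv (g g' : ℝ → ℝ) (t : ℝ) (ht : t < 1)
    (hg : ∀ z ∈ Set.Icc t 1, HasDerivAt g (g' z) z) (h0 : ∀ z ∈ Set.Icc t 1, 0 ≤ g' z) :
    g t ≤ g 1 := by
  have : MonotoneOn g (Set.Icc t 1) := by
    apply monotoneOn_of_deriv_nonneg (convex_Icc t 1)
    · exact fun z hz => (hg z hz).continuousAt.continuousWithinAt
    · exact fun z hz => (hg z (interior_subset hz)).differentiableAt.differentiableWithinAt
    · intro z hz
      rw [(hg z (interior_subset hz)).deriv]
      exact h0 z (interior_subset hz)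
  exact this (Set.left_mem_Icc.2 ht.le) (Set.right_mem_Icc.2 ht.le) ht.le

lemma mid_hasDeriv (a m z : ℝ) (ha : 0 < a) (hz : 0 < z) :
    HasDerivAt (fun z : ℝ => m ^ a * (z + a / m * ((z - m) ^ 2 / 2)) - z ^ (a + 1) / (a + 1))
      (m ^ a * (1 + a / m * (z - m)) - z ^ a) z := by
  have i := hasDerivAt_id z
  have e1 := ((i.add (((((i.sub_const m).pow 2).div_const 2).const_mul (a / m)))).const_mul (m ^ a)).sub
    ((Real.hasDerivAt_rpow_const (x := z) (p := a + 1) (Or.inl hz.ne')).div_const (a + 1))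
  refine e1.congr_deriv ?_
  have : a + 1 ≠ 0 := by positivity
  simp only [id, Nat.cast_ofNat, Nat.add_one_sub_one, pow_one]
  rw [add_sub_cancel_right]
  field_simp

lemma mid_le (a t : ℝ) (ha : 0 < a) (ha1 : a < 1) (ht : 0 < t) (ht1 : t < 1) :
    (1 - t ^ (a + 1)) / ((a + 1) * (1 - t)) ≤ ((1 + t) / 2) ^ a := by
  have hm : 0 < (1 + t) / 2 := by linarith
  have := mono_of_hasDeriv _ _ t ht1
    (fun z hz => mid_hasDeriv a ((1 + t) / 2) z ha (lt_of_lt_of_le ht hz.1)) (by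
      intro z hz
      have := tangent_le a z ((1 + t) / 2) ha.le ha1.le (lt_of_lt_of_le ht hz.1) hm
      have e : a / ((1 + t) / 2) * (z - (1 + t) / 2) = a * (z / ((1 + t) / 2) - 1) := by
        field_simp
      rw [e]; linarith)
  rw [Real.one_rpow] at this
  have h1 : 0 < 1 - t := by linarith
  rw [← div_div, div_le_iff₀ h1, sub_div]
  generalize ((1 + t) / 2) ^ a = X at *
  generalize a / ((1 + t) / 2) = Y at *
  nlinarith

lemma mid_ge (a t : ℝ) (ha1 : 1 < a) (ht : 0 < t) (ht1 : t < 1) :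
    ((1 + t) / 2) ^ a ≤ (1 - t ^ (a + 1)) / ((a + 1) * (1 - t)) := by
  have ha : 0 < a := by linarith
  have hm : 0 < (1 + t) / 2 := by linarith
  have := mono_of_hasDeriv _ _ t ht1
    (fun z hz => (mid_hasDeriv a ((1 + t) / 2) z ha (lt_of_lt_of_le ht hz.1)).neg) (by
      intro z hz
      have := tangent_ge a z ((1 + t) / 2) ha1.le (lt_of_lt_of_le ht hz.1) hm
      have e : a / ((1 + t) / 2) * (z - (1 + t) / 2) = a * (z / ((1 + t) / 2) - 1) := by
        field_simp
      rw [e]; linarith)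
  simp only [Pi.neg_apply] at this
  rw [Real.one_rpow] at this
  have h1 : 0 < 1 - t := by linarith
  rw [← div_div, le_div_iff₀ h1, sub_div]
  generalize ((1 + t) / 2) ^ a = X at *
  generalize a / ((1 + t) / 2) = Y at *
  nlinarith

lemma AB_hasDeriv (a B z : ℝ) (ha : 0 < a) (hB : 0 < B) (hz : 0 < z) :
    HasDerivAt (fun z : ℝ => z ^ a + (1 - a) / B * (z ^ (a + 1) / (a + 1)) - B ^ (a - 1) * z)
      (z ^ (a - 1) * (a + (1 - a) * (z / B)) - B ^ (a - 1)) z := by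
  have e1 := ((Real.hasDerivAt_rpow_const (x := z) (p := a) (Or.inl hz.ne')).add
    (((Real.hasDerivAt_rpow_const (x := z) (p := a + 1) (Or.inl hz.ne')).div_const
      (a + 1)).const_mul ((1 - a) / B))).sub ((hasDerivAt_id z).const_mul (B ^ (a - 1)))
  refine e1.congr_deriv ?_
  have : a + 1 ≠ 0 := by positivity
  have h2 : z ^ a = z ^ (a - 1) * z := by rw [Real.rpow_sub_one hz.ne']; field_simp
  rw [add_sub_cancel_right, h2]
  field_simp

lemma AB_alg (a t B : ℝ) (ha : 0 < a) (ht : 0 < t) (ht1 : t < 1)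
    (hBd : B = a * (1 - t ^ (a + 1)) / ((a + 1) * (1 - t ^ a))) : 0 < B ∧
      (1 - t ^ (a + 1)) / (a + 1) = B * (1 - t ^ a) / a := by
  have h1 : t ^ a < 1 := Real.rpow_lt_one ht.le ht1 ha
  have h2 : t ^ (a + 1) < 1 := Real.rpow_lt_one ht.le ht1 (by linarith)
  have h3 : 0 < 1 - t ^ a := by linarith
  have h4 : 0 < 1 - t ^ (a + 1) := by linarith
  refine ⟨by rw [hBd]; positivity, ?_⟩
  rw [hBd]; field_simp

lemma A_ge_B (a t B : ℝ) (ha : 0 < a) (ha1 : a < 1) (ht : 0 < t) (ht1 : t < 1)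
    (hBd : B = a * (1 - t ^ (a + 1)) / ((a + 1) * (1 - t ^ a))) :
    B ^ a ≤ (1 - t ^ (a + 1)) / ((a + 1) * (1 - t)) := by
  obtain ⟨hB, hal⟩ := AB_alg a t B ha ht ht1 hBd
  have := mono_of_hasDeriv _ _ t ht1
    (fun z hz => AB_hasDeriv a B z ha hB (lt_of_lt_of_le ht hz.1)) (by
      intro z hz
      have hz0 := lt_of_lt_of_le ht hz.1
      have h1 := tangent_le (1 - a) z B (by linarith) (by linarith) hz0 hB
      have h2 : z ^ (a - 1) * z ^ (1 - a) = 1 := by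
        rw [← Real.rpow_add hz0]; simp
      have h3 : B ^ (a - 1) * B ^ (1 - a) = 1 := by
        rw [← Real.rpow_add hB]; simp
      have h4 : 0 < z ^ (a - 1) := by positivity
      have h5 : 0 < B ^ (a - 1) := by positivity
      have h6 := mul_le_mul_of_nonneg_left h1 (mul_pos h4 h5).le
      have h7 : z ^ (a - 1) * B ^ (a - 1) * z ^ (1 - a) = B ^ (a - 1) := by
        linear_combination B ^ (a - 1) * h2
      have h8 : z ^ (a - 1) * B ^ (a - 1) * (B ^ (1 - a) * (1 + (1 - a) * (z / B - 1)))
          = z ^ (a - 1) * (a + (1 - a) * (z / B)) := by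
        linear_combination z ^ (a - 1) * (1 + (1 - a) * (z / B - 1)) * h3
      rw [h7, h8] at h6
      linarith)
  simp only [Real.one_rpow] at this
  have h1 : 0 < 1 - t := by linarith
  have e1 : (1 - a) / B * ((1 - t ^ (a + 1)) / (a + 1)) = (1 - t ^ a) / a - (1 - t ^ a) := by
    rw [hal]; field_simp
  have h2 : B ^ (a - 1) * (1 - t) ≤ (1 - t ^ a) / a := by
    rw [sub_div 1 (t ^ (a + 1)) (a + 1)] at e1
    linarith
  have h3 : B ^ a = B ^ (a - 1) * B := by rw [Real.rpow_sub_one hB.ne']; field_simp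
  rw [← div_div, le_div_iff₀ h1, hal, h3]
  have := mul_le_mul_of_nonneg_left h2 hB.le
  calc B ^ (a - 1) * B * (1 - t) = B * (B ^ (a - 1) * (1 - t)) := by ring
    _ ≤ _ := this
    _ = _ := by ring

lemma A_le_B (a t B : ℝ) (ha1 : 1 < a) (ht : 0 < t) (ht1 : t < 1)
    (hBd : B = a * (1 - t ^ (a + 1)) / ((a + 1) * (1 - t ^ a))) :
    (1 - t ^ (a + 1)) / ((a + 1) * (1 - t)) ≤ B ^ a := by
  have ha : 0 < a := by linarith
  obtain ⟨hB, hal⟩ := AB_alg a t B ha ht ht1 hBd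
  have := mono_of_hasDeriv _ _ t ht1
    (fun z hz => (AB_hasDeriv a B z ha hB (lt_of_lt_of_le ht hz.1)).neg) (by
      intro z hz
      have hz0 := lt_of_lt_of_le ht hz.1
      have h1 := tangent_neg (a - 1) (z / B) (by linarith) (by positivity)
      rw [Real.div_rpow hz0.le hB.le, div_mul_eq_mul_div, div_le_iff₀ (by positivity)] at h1
      have e : 1 - (a - 1) * (z / B - 1) = a + (1 - a) * (z / B) := by ring
      rw [e] at h1
      linarith)
  simp only [Pi.neg_apply, Real.one_rpow] at this
  have h1 : 0 < 1 - t := by linarith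
  have e1 : (1 - a) / B * ((1 - t ^ (a + 1)) / (a + 1)) = (1 - t ^ a) / a - (1 - t ^ a) := by
    rw [hal]; field_simp
  have h2 : (1 - t ^ a) / a ≤ B ^ (a - 1) * (1 - t) := by
    rw [sub_div 1 (t ^ (a + 1)) (a + 1)] at e1
    linarith
  have h3 : B ^ a = B ^ (a - 1) * B := by rw [Real.rpow_sub_one hB.ne']; field_simp
  rw [← div_div, div_le_iff₀ h1, hal, h3]
  have := mul_le_mul_of_nonneg_left h2 hB.le
  calc _ = B * ((1 - t ^ a) / a) := by ring
    _ ≤ _ := this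
    _ = _ := by ring

lemma b_facts (a r b : ℝ) (ha : 0 < a) (hr : 1 < r)
    (hb : b * ((a + 1) * (r ^ a - 1)) = a * (r * r ^ a - 1)) :
    1 < b ∧ b < r ∧ r ^ a * (b * (1 + a) - a * r) = b * (1 + a) - a := by
  have hR : 1 < r ^ a := Real.one_lt_rpow hr ha
  have hr0 : 0 < r := by linarith
  have hlog : 0 < Real.log r := Real.log_pos hr
  have h1 : (1 + a - a * r) * r ^ a < 1 := by
    have e1 := Real.log_le_sub_one_of_pos hr0
    have e2 := Real.add_one_lt_exp (x := -(Real.log r * a)) (by nlinarith [mul_pos hlog ha])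
    rw [Real.exp_neg, ← Real.rpow_def_of_pos hr0] at e2
    have e3 : 1 + a - a * r < (r ^ a)⁻¹ := by nlinarith
    have e4 : 0 < r ^ a := by positivity
    have e5 := mul_lt_mul_of_pos_right e3 e4
    rwa [inv_mul_cancel₀ e4.ne'] at e5
  have h2 : 1 + (a + 1) * (r - 1) < r * r ^ a := by
    have := one_add_mul_self_lt_rpow_one_add (s := r - 1) (p := a + 1) (by linarith)
      (by linarith) (by linarith)
    rw [add_sub_cancel, Real.rpow_add_one hr0.ne'] at this
    linarith
  have hc : 0 < (a + 1) * (r ^ a - 1) := mul_pos (by linarith) (by linarith)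
  refine ⟨?_, ?_, ?_⟩
  · refine lt_of_mul_lt_mul_right ?_ hc.le
    rw [hb]; nlinarith
  · refine lt_of_mul_lt_mul_right ?_ hc.le
    rw [hb]; nlinarith
  · linear_combination hb


lemma setup (a t T M B : ℝ) (ha : 0 < a) (ht : 0 < t) (ht1 : t < 1) (hT : T = t ^ a)
    (hM : M = (1 - t ^ (a + 1)) / ((a + 1) * (1 - t)))
    (hB : B = a * (1 - t ^ (a + 1)) / ((a + 1) * (1 - t ^ a))) :
    0 < T ∧ T < 1 ∧ 0 < M ∧ 0 < B ∧ M * (a * (1 - t)) = B * (1 - T) ∧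
    ∃ r b D : ℝ, r * t = 1 ∧ b * t = B ∧ D = b - a * (r - b) ∧ 1 < b ∧ b < r ∧ 0 < D ∧
      r ^ a * (b * (1 + a) - a * r) = b * (1 + a) - a ∧ M * D = T * b := by
  have h1 : t ^ a < 1 := Real.rpow_lt_one ht.le ht1 ha
  have h2 : t ^ (a + 1) < 1 := Real.rpow_lt_one ht.le ht1 (by linarith)
  have h0 : 0 < t ^ a := by positivity
  have h3 : 0 < 1 - t ^ a := by linarith
  have h4 : 0 < 1 - t ^ (a + 1) := by linarith
  have h5 : 0 < 1 - t := by linarith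
  have hMp : 0 < M := by rw [hM]; positivity
  have hBp : 0 < B := by rw [hB]; positivity
  have hp : t ^ (a + 1) = t ^ a * t := Real.rpow_add_one ht.ne' a
  subst hT
  have hMB : M * (a * (1 - t)) = B * (1 - t ^ a) := by rw [hM, hB]; field_simp
  refine ⟨h0, h1, hMp, hBp, hMB, t⁻¹, B * t⁻¹, B * t⁻¹ - a * (t⁻¹ - B * t⁻¹),
    by field_simp, by field_simp, rfl, ?_⟩
  have hr1 : 1 < t⁻¹ := (one_lt_inv₀ ht).2 ht1
  have hinv : t⁻¹ ^ a = (t ^ a)⁻¹ := Real.inv_rpow ht.le a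
  obtain ⟨f1, f2, f3⟩ := b_facts a t⁻¹ (B * t⁻¹) ha hr1 (by
    rw [hinv, hB, hp]; field_simp)
  have f4 : t⁻¹ ^ a * (B * t⁻¹ - a * (t⁻¹ - B * t⁻¹)) = B * t⁻¹ * (1 + a) - a := by
    rw [← f3]; ring
  have hRp : 0 < t⁻¹ ^ a := by positivity
  refine ⟨f1, f2, ?_, f3, ?_⟩
  · have : 0 < t⁻¹ ^ a * (B * t⁻¹ - a * (t⁻¹ - B * t⁻¹)) := by
      rw [f4]; nlinarith
    exact (pos_iff_pos_of_mul_pos this).1 hRp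
  · rw [hM, hB, hp]
    field_simp
    ring

lemma signI (a t T M A B : ℝ) (ha : 0 < a) (ha1 : a < 1) (ht : 0 < t) (ht1 : t < 1)
    (hT : T = t ^ a)
    (hM : M = (1 - t ^ (a + 1)) / ((a + 1) * (1 - t)))
    (hA : A = M ^ (1 / a))
    (hB : B = a * (1 - t ^ (a + 1)) / ((a + 1) * (1 - t ^ a))) :
    A * (M - T) / a - B * T * (B - t) / t + M * (A - B) < 0 := by
  obtain ⟨T0, T1, M0, B0, -, r, b, D, hr, hb, hD, b1, br, D0, hk, hMD⟩ :=
    setup a t T M B ha ht ht1 hT hM hB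
  have key := keyI a b r ha ha1 b1 br hk
  rw [← hD] at key
  have hAle : A ≤ (1 + t) / 2 := by
    have := mid_le a t ha ha1 ht ht1
    rw [← hM] at this
    have h2 := Real.rpow_le_rpow M0.le this (by positivity : 0 ≤ 1 / a)
    rwa [← hA, ← Real.rpow_mul (by linarith), mul_one_div_cancel ha.ne', Real.rpow_one] at h2
  have e1 : (M - T) / a * D = T * (r - b) := by
    field_simp
    rw [hD] at hMD ⊢
    linear_combination hMD
  have e2 : B * T * (B - t) / t = b * T * (b - 1) * t := by
    rw [← hb]; field_simp
  have : (A * (M - T) / a - B * T * (B - t) / t + M * (A - B)) * D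
      = T * (A * r - t * (b ^ 2 + b * (b - 1) * D)) := by
    rw [e2, mul_div_assoc]
    linear_combination A * e1 + (A - B) * hMD - T * b * (hb.symm)
  have h3 : A * r < t * (b ^ 2 + b * (b - 1) * D) := by
    have : A * r ≤ (1 + t) / 2 * r := by gcongr; linarith
    have h4 := mul_lt_mul_of_pos_left key ht
    nlinarith
  have h5 : (A * (M - T) / a - B * T * (B - t) / t + M * (A - B)) * D < 0 := by
    rw [this]
    exact mul_neg_of_pos_of_neg T0 (by linarith)
  exact (neg_iff_pos_of_mul_neg h5).2 D0

lemma signII (a t T M A B : ℝ) (ha1 : 1 < a) (ht : 0 < t) (ht1 : t < 1)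
    (hT : T = t ^ a)
    (hM : M = (1 - t ^ (a + 1)) / ((a + 1) * (1 - t)))
    (hA : A = M ^ (1 / a))
    (hB : B = a * (1 - t ^ (a + 1)) / ((a + 1) * (1 - t ^ a))) :
    0 < A * (M - T) / a - B * T * (B - t) / t := by
  have ha : 0 < a := by linarith
  obtain ⟨T0, T1, M0, B0, -, r, b, D, hr, hb, hD, b1, br, D0, hk, hMD⟩ :=
    setup a t T M B ha ht ht1 hT hM hB
  have key := keyII a b r ha1 b1 br hk
  rw [← hD] at key
  have hAge : (1 + t) / 2 ≤ A := by
    have := mid_ge a t ha1 ht ht1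
    rw [← hM] at this
    have h2 := Real.rpow_le_rpow (by positivity) this (by positivity : 0 ≤ 1 / a)
    rwa [← hA, ← Real.rpow_mul (by linarith), mul_one_div_cancel ha.ne', Real.rpow_one] at h2
  have e1 : (M - T) / a * D = T * (r - b) := by
    field_simp
    rw [hD] at hMD ⊢
    linear_combination hMD
  have e2 : B * T * (B - t) / t = b * T * (b - 1) * t := by
    rw [← hb]; field_simp
  have : (A * (M - T) / a - B * T * (B - t) / t) * D
      = T * (A * (r - b) - t * (b * (b - 1) * D)) := by
    rw [e2, mul_div_assoc]
    linear_combination A * e1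
  have h3 : t * (b * (b - 1) * D) < A * (r - b) := by
    have h5 : (1 + t) / 2 * (r - b) ≤ A * (r - b) := by
      have : 0 < r - b := by linarith
      gcongr
    have h4 := mul_lt_mul_of_pos_left key ht
    have h6 : t * ((r + 1) / 2 * (r - b)) = (1 + t) / 2 * (r - b) := by
      linear_combination (r - b) / 2 * hr
    linarith
  have h5 : 0 < (A * (M - T) / a - B * T * (B - t) / t) * D := by
    rw [this]
    exact mul_pos T0 (by linarith)
  exact (pos_iff_pos_of_mul_pos h5).2 D0

/-- The unnormalised gap with `a = p - 1`. -/
noncomputable def Fgap (a t : ℝ) : ℝ :=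
  ((1 - t ^ (a + 1)) / ((a + 1) * (1 - t))) ^ (1 / a)
    - a * (1 - t ^ (a + 1)) / ((a + 1) * (1 - t ^ a))

lemma Fgap_hasDerivAt (a t T M A B : ℝ) (ha : 0 < a) (ht : 0 < t) (ht1 : t < 1)
    (hT : T = t ^ a)
    (hM : M = (1 - t ^ (a + 1)) / ((a + 1) * (1 - t)))
    (hA : A = M ^ (1 / a))
    (hB : B = a * (1 - t ^ (a + 1)) / ((a + 1) * (1 - t ^ a))) :
    HasDerivAt (Fgap a) ((A * (M - T) / a - B * T * (B - t) / t) / (M * (1 - t))) t := by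
  obtain ⟨T0, T1, M0, B0, hMB, -⟩ := setup a t T M B ha ht ht1 hT hM hB
  have i := hasDerivAt_id t
  have h5 : 0 < 1 - t := by linarith
  have h6 : 0 < 1 - T := by linarith
  have hp : t ^ (a + 1) = T * t := by rw [hT]; exact Real.rpow_add_one ht.ne' a
  have d1 : HasDerivAt (fun t : ℝ => 1 - t ^ (a + 1)) (-((a + 1) * T)) t := by
    have := (Real.hasDerivAt_rpow_const (x := t) (p := a + 1) (Or.inl ht.ne')).const_sub 1
    rwa [add_sub_cancel_right, ← hT] at this
  have d2 : HasDerivAt (fun t : ℝ => 1 - t ^ a) (-(a * (T / t))) t := by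
    have := (Real.hasDerivAt_rpow_const (x := t) (p := a) (Or.inl ht.ne')).const_sub 1
    rwa [Real.rpow_sub_one ht.ne', ← hT] at this
  have dM : HasDerivAt (fun t : ℝ => (1 - t ^ (a + 1)) / ((a + 1) * (1 - t)))
      ((M - T) / (1 - t)) t := by
    refine (d1.div ((i.const_sub 1).const_mul (a + 1)) ?_).congr_deriv ?_
    · simp only [id]; positivity
    · rw [hM, hp]; simp only [id]; field_simp; ring
  have dA := dM.rpow_const (p := 1 / a) (Or.inl (by rw [← hM]; exact M0.ne'))
  have dB : HasDerivAt (fun t : ℝ => a * (1 - t ^ (a + 1)) / ((a + 1) * (1 - t ^ a)))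
      (a * T * (B - t) / (t * (1 - T))) t := by
    refine ((d1.const_mul a).div (d2.const_mul (a + 1)) ?_).congr_deriv ?_
    · rw [← hT]; positivity
    · rw [hB, hp, ← hT]; field_simp; ring
  refine (dA.sub dB).congr_deriv ?_
  rw [← hM, Real.rpow_sub_one M0.ne', ← hA]
  have e : 1 - T = M * (a * (1 - t)) / B := by rw [hMB]; field_simp
  rw [e]
  field_simp

lemma Fgap_continuousOn (a : ℝ) (ha : 0 < a) : ContinuousOn (Fgap a) (Set.Ico 0 1) := by
  intro t ht
  apply ContinuousAt.continuousWithinAt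
  have h1 : t ^ a < 1 := Real.rpow_lt_one ht.1 ht.2 ha
  have h2 : t ^ (a + 1) < 1 := Real.rpow_lt_one ht.1 ht.2 (by linarith)
  have h3 : 0 < 1 - t := by linarith [ht.2]
  have h4 : 0 < 1 - t ^ a := by linarith
  have c1 : ContinuousAt (fun t : ℝ => t ^ (a + 1)) t :=
    Real.continuousAt_rpow_const t (a + 1) (Or.inr (by linarith))
  have c2 : ContinuousAt (fun t : ℝ => t ^ a) t :=
    Real.continuousAt_rpow_const t a (Or.inr ha.le)
  have c3 : ContinuousAt (fun t : ℝ => 1 - t) t := by fun_prop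
  unfold Fgap
  apply ContinuousAt.sub
  · apply ContinuousAt.rpow_const
    · exact (continuousAt_const.sub c1).div (continuousAt_const.mul c3) (by positivity)
    · right; positivity
  · exact (continuousAt_const.mul (continuousAt_const.sub c1)).div
      (continuousAt_const.mul (continuousAt_const.sub c2)) (by positivity)

lemma Fgap_nonneg (a t : ℝ) (ha : 0 < a) (ha1 : a < 1) (ht : 0 < t) (ht1 : t < 1) :
    0 ≤ Fgap a t := by
  obtain ⟨T0, T1, M0, B0, -⟩ := setup a t _ _ _ ha ht ht1 rfl rfl rfl
  have h := Real.rpow_le_rpow (by positivity) (A_ge_B a t _ ha ha1 ht ht1 rfl)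
    (by positivity : 0 ≤ 1 / a)
  rw [← Real.rpow_mul B0.le, mul_one_div_cancel ha.ne', Real.rpow_one] at h
  unfold Fgap
  linarith

lemma Fgap_nonpos (a t : ℝ) (ha1 : 1 < a) (ht : 0 < t) (ht1 : t < 1) :
    Fgap a t ≤ 0 := by
  have ha : 0 < a := by linarith
  obtain ⟨T0, T1, M0, B0, -⟩ := setup a t _ _ _ ha ht ht1 rfl rfl rfl
  have h := Real.rpow_le_rpow M0.le (A_le_B a t _ ha1 ht ht1 rfl)
    (by positivity : 0 ≤ 1 / a)
  rw [← Real.rpow_mul B0.le, mul_one_div_cancel ha.ne', Real.rpow_one] at h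
  unfold Fgap
  linarith

lemma Dgap_eq (a t : ℝ) : Dgap (a + 1) t = Fgap a t / (1 - t) := by
  unfold Dgap Fgap
  rw [add_sub_cancel_right]
  ring

lemma Dgap_mul (a t : ℝ) (ht : t < 1) : (1 - t) * Dgap (a + 1) t = Fgap a t := by
  rw [Dgap_eq]
  have : 1 - t ≠ 0 := by linarith
  field_simp

lemma anti_main (a : ℝ) (ha : 0 < a) (ha1 : a < 1) :
    StrictAntiOn (Dgap (a + 1)) (Set.Ico 0 1) := by
  have hfun : Dgap (a + 1) = fun t => Fgap a t / (1 - t) := funext (Dgap_eq a)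
  rw [hfun]
  apply strictAntiOn_of_deriv_neg (convex_Ico 0 1)
  · apply (Fgap_continuousOn a ha).div (by fun_prop)
    intro t ht
    have := ht.2
    linarith
  · intro t ht
    rw [interior_Ico] at ht
    obtain ⟨T0, T1, M0, B0, -⟩ := setup a t _ _ _ ha ht.1 ht.2 rfl rfl rfl
    have h1 : 0 < 1 - t := by linarith [ht.2]
    have d := (Fgap_hasDerivAt a t _ _ _ _ ha ht.1 ht.2 rfl rfl rfl rfl).div
      ((hasDerivAt_id t).const_sub 1) h1.ne'
    have s := signI a t _ _ _ _ ha ha1 ht.1 ht.2 rfl rfl rfl rfl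
    have d' : deriv (fun t => Fgap a t / (1 - t)) t = _ := d.deriv
    rw [d']
    apply div_neg_of_neg_of_pos _ (by simp only [id]; positivity)
    simp only [id]
    rw [show Fgap a t = ((1 - t ^ (a + 1)) / ((a + 1) * (1 - t))) ^ (1 / a)
      - a * (1 - t ^ (a + 1)) / ((a + 1) * (1 - t ^ a)) from rfl]
    generalize a * (1 - t ^ (a + 1)) / ((a + 1) * (1 - t ^ a)) = B at *
    generalize (1 - t ^ (a + 1)) / ((a + 1) * (1 - t)) = M at *
    generalize M ^ (1 / a) = A at *
    generalize hX : A * (M - t ^ a) / a - B * t ^ a * (B - t) / t = X at *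
    have e : X / (M * (1 - t)) * (1 - t) - (A - B) * -1 = (X + M * (A - B)) / M := by
      field_simp
      ring
    rw [e]
    exact div_neg_of_neg_of_pos s M0

lemma mono_main (a : ℝ) (ha1 : 1 < a) :
    StrictMonoOn (Fgap a) (Set.Ico 0 1) := by
  have ha : 0 < a := by linarith
  apply strictMonoOn_of_deriv_pos (convex_Ico 0 1) (Fgap_continuousOn a ha)
  intro t ht
  rw [interior_Ico] at ht
  obtain ⟨T0, T1, M0, B0, -⟩ := setup a t _ _ _ ha ht.1 ht.2 rfl rfl rfl
  have h1 : 0 < 1 - t := by linarith [ht.2]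
  rw [(Fgap_hasDerivAt a t _ _ _ _ ha ht.1 ht.2 rfl rfl rfl rfl).deriv]
  exact div_pos (signII a t _ _ _ _ ha1 ht.1 ht.2 rfl rfl rfl rfl) (mul_pos M0 h1)

/-- (i) For `1 < p < 2`, `t ↦ Δ(p,t)` is strictly decreasing on `[0,1)` and
`0 < Δ(p,t) ≤ Δ(p,0)`; (ii) for `p > 2`, `t ↦ (1−t)Δ(p,t)` is strictly increasing
on `[0,1)` and `Δ(p,0) ≤ (1−t)Δ(p,t) < 0`. -/
theorem Dgap_monotonicity (p : ℝ) :
    ((1 < p ∧ p < 2) → StrictAntiOn (Dgap p) (Set.Ico 0 1) ∧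
      ∀ t ∈ Set.Ico (0 : ℝ) 1, 0 < Dgap p t ∧ Dgap p t ≤ Dgap p 0) ∧
    (2 < p → StrictMonoOn (fun t => (1 - t) * Dgap p t) (Set.Ico 0 1) ∧
      ∀ t ∈ Set.Ico (0 : ℝ) 1, Dgap p 0 ≤ (1 - t) * Dgap p t ∧ (1 - t) * Dgap p t < 0) := by
  constructor
  · rintro ⟨h1, h2⟩
    obtain ⟨a, rfl⟩ : ∃ a, p = a + 1 := ⟨p - 1, by ring⟩
    have ha : 0 < a := by linarith
    have ha1 : a < 1 := by linarith
    have hm := anti_main a ha ha1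
    refine ⟨hm, fun t ht => ⟨?_, ?_⟩⟩
    · have h0 := ht.1
      have h3 := ht.2
      have h4 : (1 + t) / 2 ∈ Set.Ico (0 : ℝ) 1 := ⟨by linarith, by linarith⟩
      have h5 := hm ht h4 (by linarith)
      have h6 := Fgap_nonneg a ((1 + t) / 2) ha ha1 (by linarith) h4.2
      have h7 : 0 ≤ Dgap (a + 1) ((1 + t) / 2) := by
        rw [Dgap_eq]
        exact div_nonneg h6 (by linarith)
      linarith
    · exact hm.antitoneOn (Set.left_mem_Ico.2 one_pos) ht ht.1
  · intro h2
    obtain ⟨a, rfl⟩ : ∃ a, p = a + 1 := ⟨p - 1, by ring⟩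
    have ha1 : 1 < a := by linarith
    have hm := mono_main a ha1
    refine ⟨fun s hs t ht hst => ?_, fun t ht => ⟨?_, ?_⟩⟩
    · simp only
      rw [Dgap_mul a s hs.2, Dgap_mul a t ht.2]
      exact hm hs ht hst
    · rw [Dgap_mul a t ht.2]
      have h3 := Dgap_mul a 0 one_pos
      rw [sub_zero, one_mul] at h3
      rw [h3]
      exact hm.monotoneOn (Set.left_mem_Ico.2 one_pos) ht ht.1
    · rw [Dgap_mul a t ht.2]
      have h0 := ht.1
      have h3 := ht.2
      have h4 : (1 + t) / 2 ∈ Set.Ico (0 : ℝ) 1 := ⟨by linarith, by linarith⟩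
      have h5 := hm ht h4 (by linarith)
      have h6 := Fgap_nonpos a ((1 + t) / 2) ha1 (by linarith) h4.2
      linarith
end

section
/- Define Δ(p) := (1/p)^{1/(p−1)} − (p−1)/p for p > 1. Then: (i) Δ(p) > 0 for 1 < p < 2, Δ(2) = 0, and Δ(p) < 0 for p > 2; (ii) Δ(p) → e^{−1} as p → 1⁺, and Δ(p) → 0 as p → ∞; (iii) there exists a unique p₀ > 1 satisfying −p₀/(p₀−1) + p₀²·log(p₀)/(p₀−1)² − p₀^{1/(p₀−1)} = 0, and Δ is strictly decreasing on (1, p₀) and strictly increasing on (p₀, ∞); in particular Δ attains its minimum over (1, ∞) exactly at p₀. -/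
/-- `Δ(p) = (1/p)^{1/(p−1)} − (p−1)/p`, the normalized gap at `t = 0`. -/
noncomputable def Dlt (p : ℝ) : ℝ := (1 / p) ^ (1 / (p - 1)) - (p - 1) / p

open Real Set Filter Topology

noncomputable def rr (p : ℝ) : ℝ := Real.log p / (p - 1)
noncomputable def AA (p : ℝ) : ℝ := (p ^ 2 * Real.log p - p ^ 2 + p) / (p - 1) ^ 2
noncomputable def GG (p : ℝ) : ℝ := AA p - Real.exp (rr p)

lemma Dlt_eq {p : ℝ} (hp : 1 < p) : Dlt p = Real.exp (-rr p) - 1 + p⁻¹ := by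
  have h0 : 0 < p := by linarith
  unfold Dlt rr
  rw [Real.rpow_def_of_pos (by positivity), one_div, Real.log_inv]
  have : (p - 1) / p = 1 - p⁻¹ := by field_simp
  rw [this]
  ring_nf

lemma GG_eq {p : ℝ} (hp : 1 < p) :
    -(p / (p - 1)) + p ^ 2 * Real.log p / (p - 1) ^ 2 - p ^ (1 / (p - 1)) = GG p := by
  have h0 : 0 < p := by linarith
  have h1 : p - 1 ≠ 0 := by linarith
  unfold GG AA rr
  rw [Real.rpow_def_of_pos h0, mul_one_div]
  congr 1
  field_simp
  ring

lemma aux1 {p : ℝ} (hp : 1 < p) : p - 1 < p * Real.log p := by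
  have h0 : 0 < p := by linarith
  have h := Real.log_lt_sub_one_of_pos (inv_pos.2 h0) (by simpa using hp.ne')
  rw [Real.log_inv] at h
  have : p * p⁻¹ = 1 := mul_inv_cancel₀ h0.ne'
  nlinarith

lemma aux2 {p : ℝ} (hp : 1 < p) : 0 < p ^ 2 - 1 - 2 * p * Real.log p := by
  have hd : ∀ x : ℝ, 0 < x → HasDerivAt (fun x : ℝ => x ^ 2 - 1 - 2 * x * Real.log x)
      (2 * x - 2 * Real.log x - 2) x := by
    intro x hx
    have := (((hasDerivAt_id x).pow 2).sub_const 1).sub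
      (((hasDerivAt_id x).const_mul 2).mul (Real.hasDerivAt_log hx.ne'))
    refine HasDerivAt.congr_deriv this ?_
    simp
    field_simp
    ring
  have hm : StrictMonoOn (fun x : ℝ => x ^ 2 - 1 - 2 * x * Real.log x) (Ici 1) := by
    apply strictMonoOn_of_deriv_pos (convex_Ici 1)
    · intro x hx
      exact (hd x (lt_of_lt_of_le one_pos hx)).continuousAt.continuousWithinAt
    · intro x hx
      rw [interior_Ici] at hx
      have hx' : 1 < x := hx
      rw [(hd x (by linarith)).deriv]
      have := Real.log_lt_sub_one_of_pos (by linarith : 0 < x) hx'.ne'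
      linarith
  have := hm (mem_Ici.2 le_rfl) (mem_Ici.2 hp.le) hp
  simpa using this

lemma rr_deriv {p : ℝ} (hp : 1 < p) :
    HasDerivAt rr ((p⁻¹ * (p - 1) - Real.log p) / (p - 1) ^ 2) p := by
  have h0 : p ≠ 0 := by linarith
  have h1 : p - 1 ≠ 0 := by linarith
  have := (Real.hasDerivAt_log h0).div ((hasDerivAt_id p).sub_const 1) h1
  refine HasDerivAt.congr_deriv this ?_
  simp

lemma rr_deriv_neg {p : ℝ} (hp : 1 < p) :
    (p⁻¹ * (p - 1) - Real.log p) / (p - 1) ^ 2 < 0 := by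
  have h0 : 0 < p := by linarith
  have h1 : 0 < p - 1 := by linarith
  apply div_neg_of_neg_of_pos _ (by positivity)
  have := aux1 hp
  have : p⁻¹ * (p - 1) < p⁻¹ * (p * Real.log p) := by gcongr
  rw [inv_mul_cancel_left₀ h0.ne'] at this
  linarith

lemma AA_deriv {p : ℝ} (hp : 1 < p) :
    HasDerivAt AA ((p ^ 2 - 1 - 2 * p * Real.log p) / (p - 1) ^ 3) p := by
  have h0 : p ≠ 0 := by linarith
  have h1 : p - 1 ≠ 0 := by linarith
  have := (((((hasDerivAt_id p).pow 2).mul (Real.hasDerivAt_log h0)).sub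
    ((hasDerivAt_id p).pow 2)).add (hasDerivAt_id p)).div
    (((hasDerivAt_id p).sub_const 1).pow 2) (pow_ne_zero 2 h1)
  refine HasDerivAt.congr_deriv this ?_
  simp
  field_simp
  ring

lemma GG_deriv {p : ℝ} (hp : 1 < p) : HasDerivAt GG
    ((p ^ 2 - 1 - 2 * p * Real.log p) / (p - 1) ^ 3 -
      Real.exp (rr p) * ((p⁻¹ * (p - 1) - Real.log p) / (p - 1) ^ 2)) p :=
  (AA_deriv hp).sub (rr_deriv hp).exp

lemma GG_mono : StrictMonoOn GG (Ioi 1) := by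
  apply strictMonoOn_of_deriv_pos (convex_Ioi 1)
  · intro x hx
    exact (GG_deriv hx).continuousAt.continuousWithinAt
  · intro x hx
    rw [interior_Ioi] at hx
    have hx' : 1 < x := hx
    rw [(GG_deriv hx).deriv]
    have h1 : 0 < (x ^ 2 - 1 - 2 * x * Real.log x) / (x - 1) ^ 3 :=
      div_pos (aux2 hx) (pow_pos (by linarith) 3)
    have h2 := mul_neg_of_pos_of_neg (Real.exp_pos (rr x)) (rr_deriv_neg hx)
    linarith

lemma rr_anti : StrictAntiOn rr (Ioi 1) := by
  apply strictAntiOn_of_deriv_neg (convex_Ioi 1)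
  · intro x hx
    exact (rr_deriv hx).continuousAt.continuousWithinAt
  · intro x hx
    rw [interior_Ioi] at hx
    rw [(rr_deriv hx).deriv]
    exact rr_deriv_neg hx

lemma exp_rr_two : Real.exp (rr 2) = 2 := by
  unfold rr
  norm_num
  exact Real.exp_log (by norm_num)

lemma GG_two : GG 2 < 0 := by
  unfold GG
  rw [exp_rr_two]
  unfold AA
  have := Real.log_two_lt_d9
  norm_num
  linarith

lemma exp_three_gt : (2 : ℝ) < Real.exp 3 := by
  have := Real.add_one_lt_exp (by norm_num : (3 : ℝ) ≠ 0)
  linarith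

lemma GG_big : 0 < GG (Real.exp 3) := by
  have h2 := exp_three_gt
  have h := rr_anti (mem_Ioi.2 one_lt_two) (mem_Ioi.2 (by linarith)) h2
  have h3 := Real.exp_lt_exp.2 h
  rw [exp_rr_two] at h3
  have : 2 < AA (Real.exp 3) := by
    unfold AA
    rw [Real.log_exp, lt_div_iff₀ (by apply pow_pos; linarith)]
    nlinarith
  unfold GG
  linarith

lemma exists_root : ∃ p₀ : ℝ, 2 < p₀ ∧ GG p₀ = 0 := by
  have hc : ContinuousOn GG (Icc 2 (Real.exp 3)) := fun x hx =>
    (GG_deriv (lt_of_lt_of_le one_lt_two hx.1)).continuousAt.continuousWithinAt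
  obtain ⟨x, hx, hx0⟩ := intermediate_value_Ioo exp_three_gt.le hc ⟨GG_two, GG_big⟩
  exact ⟨x, hx.1, hx0⟩

lemma Dlt_deriv {p : ℝ} (hp : 1 < p) :
    HasDerivAt Dlt (Real.exp (-rr p) / p ^ 2 * GG p) p := by
  have h0 : p ≠ 0 := by linarith
  have h1 : p - 1 ≠ 0 := by linarith
  have h := (((rr_deriv hp).neg.exp).sub_const 1).add (hasDerivAt_inv h0)
  have he : Dlt =ᶠ[𝓝 p] fun p => Real.exp (-rr p) - 1 + p⁻¹ := by
    filter_upwards [Ioi_mem_nhds hp] with x hx using Dlt_eq hx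
  refine HasDerivAt.congr_of_eventuallyEq ?_ he
  refine HasDerivAt.congr_deriv h ?_
  symm
  have hE : Real.exp (-rr p) * Real.exp (rr p) = 1 := by rw [← Real.exp_add]; simp
  have : Real.exp (-rr p) / p ^ 2 * GG p = Real.exp (-rr p) / p ^ 2 * AA p
      - (Real.exp (-rr p) * Real.exp (rr p)) / p ^ 2 := by
    unfold GG; ring
  rw [this, hE]
  unfold AA
  simp only [Pi.neg_apply]
  field_simp
  ring

lemma Dlt_two : Dlt 2 = 0 := by
  unfold Dlt; norm_num

lemma lim_one : Tendsto Dlt (𝓝[>] 1) (𝓝 (Real.exp (-1))) := by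
  have h1 : Tendsto rr (𝓝[>] 1) (𝓝 1) := by
    have := (Real.hasDerivAt_log one_ne_zero).tendsto_slope
    have := this.mono_left (nhdsWithin_mono 1 (fun x (hx : 1 < x) => hx.ne'))
    rw [inv_one] at this
    refine this.congr fun x => ?_
    simp [slope_def_field, rr]
  have h2 : Tendsto (fun x : ℝ => x⁻¹) (𝓝[>] 1) (𝓝 1) := by
    have := (continuousAt_inv₀ (one_ne_zero (α := ℝ))).tendsto
    rw [inv_one] at this
    exact this.mono_left nhdsWithin_le_nhds
  have h3 := (((Real.continuous_exp.tendsto _).comp h1.neg).sub_const 1).add h2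
  rw [sub_add_cancel] at h3
  refine h3.congr' ?_
  filter_upwards [self_mem_nhdsWithin] with x hx
  exact (Dlt_eq hx).symm

lemma lim_top : Tendsto Dlt atTop (𝓝 0) := by
  have h1 : Tendsto rr atTop (𝓝 0) := by
    have := Real.tendsto_pow_log_div_mul_add_atTop 1 (-1) 1 one_ne_zero
    refine this.congr fun x => ?_
    simp [rr, sub_eq_add_neg]
  have h3 := (((Real.continuous_exp.tendsto _).comp h1.neg).sub_const 1).add
    (tendsto_inv_atTop_zero (𝕜 := ℝ))
  simp only [neg_zero, Real.exp_zero, sub_self, add_zero] at h3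
  refine h3.congr' ?_
  filter_upwards [Ioi_mem_atTop 1] with x hx
  exact (Dlt_eq hx).symm


/-- Behavior of `Δ(p)` for `p > 1`: signs, limits at `1⁺` and `∞`, and the unique
interior minimum at `p₀` where `−p₀/(p₀−1) + p₀² log p₀/(p₀−1)² − p₀^{1/(p₀−1)} = 0`. -/
theorem Dlt_behavior :
    (∀ p : ℝ, 1 < p → p < 2 → 0 < Dlt p) ∧
    Dlt 2 = 0 ∧
    (∀ p : ℝ, 2 < p → Dlt p < 0) ∧
    Filter.Tendsto Dlt (nhdsWithin 1 (Set.Ioi 1)) (nhds (Real.exp (-1))) ∧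
    Filter.Tendsto Dlt Filter.atTop (nhds 0) ∧
    ∃ p₀ : ℝ, 1 < p₀ ∧
      (-(p₀ / (p₀ - 1)) + p₀ ^ 2 * Real.log p₀ / (p₀ - 1) ^ 2 - p₀ ^ (1 / (p₀ - 1)) = 0) ∧
      (∀ q : ℝ, 1 < q →
        -(q / (q - 1)) + q ^ 2 * Real.log q / (q - 1) ^ 2 - q ^ (1 / (q - 1)) = 0 → q = p₀) ∧
      StrictAntiOn Dlt (Set.Ioo 1 p₀) ∧
      StrictMonoOn Dlt (Set.Ioi p₀) ∧
      (∀ q : ℝ, 1 < q → q ≠ p₀ → Dlt p₀ < Dlt q) := by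
  obtain ⟨p₀, h2, hG⟩ := exists_root
  have h1 : 1 < p₀ := by linarith
  have hA : StrictAntiOn Dlt (Ioc 1 p₀) := by
    apply strictAntiOn_of_deriv_neg (convex_Ioc 1 p₀)
    · intro x hx
      exact (Dlt_deriv hx.1).continuousAt.continuousWithinAt
    · intro x hx
      rw [interior_Ioc] at hx
      rw [(Dlt_deriv hx.1).deriv]
      have hx0 : 0 < x := by linarith [hx.1]
      have := GG_mono hx.1 h1 hx.2
      exact mul_neg_of_pos_of_neg (by positivity) (by linarith)
  have hM : StrictMonoOn Dlt (Ici p₀) := by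
    apply strictMonoOn_of_deriv_pos (convex_Ici p₀)
    · intro x hx
      exact (Dlt_deriv (lt_of_lt_of_le h1 hx)).continuousAt.continuousWithinAt
    · intro x hx
      rw [interior_Ici] at hx
      have hx' : p₀ < x := hx
      have hx1 : 1 < x := h1.trans hx'
      rw [(Dlt_deriv hx1).deriv]
      have hx0 : 0 < x := by linarith
      have := GG_mono h1 hx1 hx'
      exact mul_pos (by positivity) (by linarith)
  refine ⟨?_, Dlt_two, ?_, lim_one, lim_top, p₀, h1, ?_, ?_, ?_, ?_, ?_⟩
  · intro p hp hp2
    have := hA ⟨hp, by linarith⟩ ⟨one_lt_two, h2.le⟩ hp2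
    rwa [Dlt_two] at this
  · intro p hp
    rcases le_total p p₀ with h | h
    · have := hA ⟨one_lt_two, h2.le⟩ ⟨by linarith, h⟩ hp
      rwa [Dlt_two] at this
    · have hlt : Dlt p < Dlt (p + 1) :=
        hM (mem_Ici.2 h) (mem_Ici.2 (by linarith)) (by linarith)
      refine lt_of_lt_of_le hlt (ge_of_tendsto lim_top ?_)
      filter_upwards [Ici_mem_atTop (p + 1)] with x hx
      have hx' : p + 1 ≤ x := hx
      exact hM.monotoneOn (mem_Ici.2 (by linarith)) (mem_Ici.2 (by linarith)) hx'
  · rw [GG_eq h1, hG]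
  · intro q hq hq0
    rw [GG_eq hq] at hq0
    exact GG_mono.injOn hq h1 (hq0.trans hG.symm)
  · exact hA.mono Ioo_subset_Ioc_self
  · exact hM.mono Ioi_subset_Ici_self
  · intro q hq hne
    rcases lt_or_gt_of_ne hne with h | h
    · exact hA ⟨hq, h.le⟩ ⟨h1, le_rfl⟩ h
    · exact hM (mem_Ici.2 le_rfl) (mem_Ici.2 h.le) h
end

section
/- Let p > 1 and let x be a real number with x > 0 and x ≠ 1. Then p(p−1)(1−x)·x^{p−1}·log(x) + (x^{p−1} − 1)(x^p − 1) > 0. -/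
lemma aux_sinh_mul (p s : ℝ) (hp : 1 < p) (hs : 0 < s) :
    p * Real.sinh s ≤ Real.sinh (p * s) := by
  have hd : ∀ t : ℝ, HasDerivAt (fun t => Real.sinh (p * t) - p * Real.sinh t)
      (Real.cosh (p * t) * (p * 1) - p * Real.cosh t) t := fun t =>
    (((hasDerivAt_id t).const_mul p).sinh).sub ((Real.hasDerivAt_sinh t).const_mul p)
  have hm : MonotoneOn (fun t => Real.sinh (p * t) - p * Real.sinh t) (Set.Ici 0) := by
    apply monotoneOn_of_deriv_nonneg (convex_Ici 0)
    · exact fun t _ => (hd t).continuousAt.continuousWithinAt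
    · exact fun t _ => (hd t).differentiableAt.differentiableWithinAt
    · intro t ht
      rw [interior_Ici, Set.mem_Ioi] at ht
      rw [(hd t).deriv]
      have : Real.cosh t ≤ Real.cosh (p * t) := by
        rw [Real.cosh_le_cosh, abs_of_pos ht, abs_of_pos (by positivity)]
        nlinarith
      nlinarith
  have := hm (Set.mem_Ici.2 le_rfl) (Set.mem_Ici.2 hs.le) hs.le
  simp at this
  linarith

lemma aux_pos (p s : ℝ) (hp : 1 < p) (hs : 0 < s) :
    p * (p - 1) * s * Real.sinh s < Real.sinh ((p - 1) * s) * Real.sinh (p * s) := by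
  have h1 := aux_sinh_mul p s hp hs
  have h0 : 0 < (p - 1) * s := mul_pos (by linarith) hs
  have h2 : (p - 1) * s < Real.sinh ((p - 1) * s) := Real.self_lt_sinh_iff.2 h0
  have h3 : 0 < p * Real.sinh s := mul_pos (by linarith) (Real.sinh_pos_iff.2 hs)
  calc p * (p - 1) * s * Real.sinh s = ((p - 1) * s) * (p * Real.sinh s) := by ring
    _ < Real.sinh ((p - 1) * s) * (p * Real.sinh s) := mul_lt_mul_of_pos_right h2 h3
    _ ≤ _ := mul_le_mul_of_nonneg_left h1 (by linarith)

lemma aux_ne (p s : ℝ) (hp : 1 < p) (hs : s ≠ 0) :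
    p * (p - 1) * s * Real.sinh s < Real.sinh ((p - 1) * s) * Real.sinh (p * s) := by
  rcases lt_or_gt_of_ne hs with h | h
  · have := aux_pos p (-s) hp (by linarith)
    simpa only [mul_neg, Real.sinh_neg, neg_mul, neg_neg] using this
  · exact aux_pos p s hp h

/-- For `p > 1` and `x > 0`, `x ≠ 1`:
`p(p−1)(1−x)x^{p−1} log x + (x^{p−1} − 1)(xᵖ − 1) > 0`. -/
theorem key_log_inequality (p x : ℝ) (hp : 1 < p) (hx : 0 < x) (hx1 : x ≠ 1) :
    0 < p * (p - 1) * (1 - x) * x ^ (p - 1) * Real.log x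
        + (x ^ (p - 1) - 1) * (x ^ p - 1) := by
  obtain ⟨s, rfl⟩ : ∃ s, x = Real.exp (s + s) :=
    ⟨Real.log x / 2, by rw [add_halves, Real.exp_log hx]⟩
  have hs : s ≠ 0 := by
    rintro rfl
    simp at hx1
  have h := aux_ne p s hp hs
  have e1 : Real.exp (s + s) ^ (p - 1)
      = Real.exp ((p - 1) * s) * Real.exp ((p - 1) * s) := by
    rw [← Real.exp_mul, ← Real.exp_add]; ring_nf
  have e2 : Real.exp (s + s) ^ p = Real.exp ((p - 1) * s) * Real.exp ((p - 1) * s)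
      * (Real.exp s * Real.exp s) := by
    rw [← Real.exp_mul, ← Real.exp_add, ← Real.exp_add, ← Real.exp_add]; ring_nf
  have e3 : Real.exp (p * s) = Real.exp ((p - 1) * s) * Real.exp s := by
    rw [← Real.exp_add]; ring_nf
  rw [Real.log_exp, e1, e2, Real.exp_add]
  simp only [Real.sinh_eq, Real.exp_neg, e3] at h
  have hA := Real.exp_pos ((p - 1) * s)
  have hB := Real.exp_pos s
  generalize Real.exp ((p - 1) * s) = A at *
  generalize Real.exp s = B at *
  have := mul_pos (mul_pos (mul_pos (four_pos (α := ℝ)) hA) (mul_pos hA hB)) (sub_pos.2 h)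
  refine this.trans_eq ?_
  field_simp
  ring
end
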